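/- arXiv:2409.18514 — 3 statements merged into one kernel-verified Lean document; each statement's English description precedes it below -/
import Mathlib

section
/- Let 𝓔 : B(ℋ) → B(ℋ) be an ergodic quantum channel on a finite-dimensional Hilbert space ℋ. Then there exists K ∈ ℕ, K ≥ 1, such that the peripheral spectrum of 𝓔 is exactly the set of K-th roots of unity, σ_φ(𝓔) = {e^{2πiℓ/K} : ℓ = 0, …, K−1}, and every peripheral eigenvalue of 𝓔 has algebraic multiplicity 1 (is non-degenerate). -/
open Matrix Kronecker
open scoped ComplexOrder
noncomputable section

abbrev MatC (n : ℕ) := Matrix (Fin n) (Fin n) ℂ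

/-- The Choi-Jamiołkowski matrix of a linear map on matrices. -/
def choi {n : ℕ} (E : MatC n →ₗ[ℂ] MatC n) : Matrix (Fin n × Fin n) (Fin n × Fin n) ℂ :=
  fun p q => E (Matrix.single p.2 q.2 1) p.1 q.1

/-- A quantum channel: a completely positive (equivalently, with positive semidefinite
Choi matrix) and trace-preserving linear map. -/
def IsQuantumChannel {n : ℕ} (E : MatC n →ₗ[ℂ] MatC n) : Prop :=
  (choi E).PosSemidef ∧ ∀ A : MatC n, (E A).trace = A.trace

/-- A channel is ergodic when its fixed-point space is one-dimensional. -/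
def IsErgodic {n : ℕ} (E : MatC n →ₗ[ℂ] MatC n) : Prop :=
  Module.finrank ℂ (Module.End.eigenspace E 1) = 1



section helpers

/-- Linear map with given Kraus operators. -/
def krausMap {n : ℕ} {ι : Type} [Fintype ι] (K : ι → MatC n) : MatC n →ₗ[ℂ] MatC n where
  toFun X := ∑ i, K i * X * (K i)ᴴ
  map_add' X Y := by simp [mul_add, add_mul, Finset.sum_add_distrib]
  map_smul' c X := by simp [Finset.smul_sum]

lemma krausMap_apply {n : ℕ} {ι : Type} [Fintype ι] (K : ι → MatC n) (X : MatC n) :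
    krausMap K X = ∑ i, K i * X * (K i)ᴴ := rfl

/-- The dual (Heisenberg picture) map. -/
def krausDual {n : ℕ} {ι : Type} [Fintype ι] (K : ι → MatC n) : MatC n →ₗ[ℂ] MatC n where
  toFun X := ∑ i, (K i)ᴴ * X * K i
  map_add' X Y := by simp [mul_add, add_mul, Finset.sum_add_distrib]
  map_smul' c X := by simp [Finset.smul_sum]

lemma krausDual_apply {n : ℕ} {ι : Type} [Fintype ι] (K : ι → MatC n) (X : MatC n) :
    krausDual K X = ∑ i, (K i)ᴴ * X * K i := rfl

open scoped MatrixOrder in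
lemma psd_factor {m : Type} [Fintype m] [DecidableEq m] {A : Matrix m m ℂ} (hA : A.PosSemidef) :
    ∃ B : Matrix m m ℂ, A = Bᴴ * B := by
  have h : (0 : Matrix m m ℂ) ≤ A := Matrix.nonneg_iff_posSemidef.mpr hA
  obtain ⟨B, hB⟩ := CStarAlgebra.nonneg_iff_eq_star_mul_self.mp h
  exact ⟨B, hB⟩

lemma exists_kraus {n : ℕ} (E : MatC n →ₗ[ℂ] MatC n) (hE : IsQuantumChannel E) :
    ∃ K : (Fin n × Fin n) → MatC n, E = krausMap K ∧ ∑ i, (K i)ᴴ * K i = 1 := by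
  obtain ⟨hP, hT⟩ := hE
  obtain ⟨B, hB⟩ := psd_factor hP
  let K : (Fin n × Fin n) → MatC n := fun r => Matrix.of fun i k => star (B r (i, k))
  have hEK : E = krausMap K := by
    apply Matrix.ext_linearMap
    intro k l
    ext1
    simp only [LinearMap.comp_apply]
    ext i j
    have h1 := congrFun (congrFun hB (i, k)) (j, l)
    have h2 : E (Matrix.single k l 1) i j = choi E (i, k) (j, l) := rfl
    rw [Matrix.mul_apply] at h1
    simp only [Matrix.singleLinearMap]
    erw [h2, h1, krausMap_apply]
    rw [Matrix.sum_apply]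
    refine Finset.sum_congr rfl fun r _ => ?_
    simp [K, Matrix.mul_apply, Matrix.single, ite_and]
  refine ⟨K, hEK, ?_⟩
  apply Matrix.ext_iff_trace_mul_left.mpr
  intro X
  rw [mul_one, ← hT X, hEK, krausMap_apply, Matrix.trace_sum, Finset.mul_sum, Matrix.trace_sum]
  refine Finset.sum_congr rfl fun r _ => ?_
  rw [← mul_assoc, Matrix.trace_mul_comm, ← mul_assoc]

variable {n : ℕ} {ι : Type} [Fintype ι] (K : ι → MatC n)

lemma trace_kraus_dual (X Y : MatC n) :
    (krausMap K X * Y).trace = (X * krausDual K Y).trace := by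
  rw [krausMap_apply, krausDual_apply, Finset.sum_mul, Finset.mul_sum, Matrix.trace_sum,
    Matrix.trace_sum]
  refine Finset.sum_congr rfl fun r _ => ?_
  rw [mul_assoc, mul_assoc, Matrix.trace_mul_comm]
  simp only [mul_assoc]

lemma kraus_psd {X : MatC n} (hX : X.PosSemidef) : (krausMap K X).PosSemidef := by
  rw [krausMap_apply]
  exact Matrix.posSemidef_sum _ fun i _ => hX.mul_mul_conjTranspose_same _

lemma kraus_pow_psd {X : MatC n} (hX : X.PosSemidef) (N : ℕ) :
    ((krausMap K ^ N) X).PosSemidef := by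
  induction N with
  | zero => simpa using hX
  | succ N ih => rw [pow_succ']; exact kraus_psd K ih

lemma kraus_star (X : MatC n) : krausMap K Xᴴ = (krausMap K X)ᴴ := by
  simp [krausMap_apply, Matrix.conjTranspose_sum, mul_assoc]

lemma krausDual_star (X : MatC n) : krausDual K Xᴴ = (krausDual K X)ᴴ := by
  simp [krausDual_apply, Matrix.conjTranspose_sum, mul_assoc]

variable {K}

lemma kraus_trace (hK : ∑ i, (K i)ᴴ * K i = 1) (X : MatC n) :
    (krausMap K X).trace = X.trace := by
  have := trace_kraus_dual K X 1
  rwa [mul_one, krausDual_apply, show ∑ i, (K i)ᴴ * 1 * K i = 1 by simpa using hK, mul_one] at this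

lemma kraus_pow_trace (hK : ∑ i, (K i)ᴴ * K i = 1) (X : MatC n) (N : ℕ) :
    ((krausMap K ^ N) X).trace = X.trace := by
  induction N with
  | zero => simp
  | succ N ih => rw [pow_succ', Module.End.mul_apply, kraus_trace hK, ih]

lemma psd_entry_bound {A : MatC n} (hA : A.PosSemidef) (i j : Fin n) :
    ‖A i j‖ ≤ ‖A.trace‖ := by
  obtain ⟨B, rfl⟩ := psd_factor hA
  have hd : ∀ k, ((Bᴴ * B) k k) = ((∑ r, ‖B r k‖ ^ 2 : ℝ) : ℂ) := by
    intro k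
    simp only [Matrix.mul_apply, Matrix.conjTranspose_apply]
    push_cast
    refine Finset.sum_congr rfl fun r _ => ?_
    exact Complex.conj_mul' _
  have ht : (Bᴴ * B).trace = ((∑ k, ∑ r, ‖B r k‖ ^ 2 : ℝ) : ℂ) := by
    rw [Matrix.trace]
    simp only [Matrix.diag_apply, hd]
    push_cast; rfl
  have hnn : ∀ k, 0 ≤ ∑ r, ‖B r k‖ ^ 2 := fun k => Finset.sum_nonneg fun r _ => by positivity
  have hle : ∀ k, ∑ r, ‖B r k‖ ^ 2 ≤ ∑ k, ∑ r, ‖B r k‖ ^ 2 := fun k =>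
    Finset.single_le_sum (f := fun k => ∑ r, ‖B r k‖ ^ 2) (fun k _ => hnn k) (Finset.mem_univ k)
  rw [ht, Complex.norm_real, Real.norm_eq_abs, abs_of_nonneg ((hnn i).trans (hle i))]
  calc ‖(Bᴴ * B) i j‖ ≤ ∑ r, ‖B r i‖ * ‖B r j‖ := by
        rw [Matrix.mul_apply]
        refine (norm_sum_le _ _).trans (le_of_eq ?_)
        simp
    _ ≤ ∑ r, (‖B r i‖ ^ 2 + ‖B r j‖ ^ 2) / 2 := by
        refine Finset.sum_le_sum fun r _ => ?_
        nlinarith [sq_nonneg (‖B r i‖ - ‖B r j‖)]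
    _ = ((∑ r, ‖B r i‖ ^ 2) + ∑ r, ‖B r j‖ ^ 2) / 2 := by
        rw [← Finset.sum_div, Finset.sum_add_distrib]
    _ ≤ _ := by linarith [hle i, hle j]

lemma polar_eq (X : MatC n) :
    X = (1/4 : ℂ) • ((X + 1) * (X + 1)ᴴ) + (-1/4 : ℂ) • ((X - 1) * (X - 1)ᴴ)
      + (Complex.I/4) • ((X + Complex.I • 1) * (X + Complex.I • 1)ᴴ)
      + (-Complex.I/4) • ((X - Complex.I • 1) * (X - Complex.I • 1)ᴴ) := by
  have hI : Complex.I ^ 2 = -1 := Complex.I_sq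
  simp only [Matrix.conjTranspose_add, Matrix.conjTranspose_sub, Matrix.conjTranspose_one,
    Matrix.conjTranspose_smul, mul_add, add_mul, mul_sub, sub_mul, mul_one, one_mul,
    Matrix.smul_mul, Matrix.mul_smul, Complex.star_def, Complex.conj_I]
  ext i j
  simp only [Matrix.add_apply, Matrix.sub_apply, Matrix.smul_apply, smul_eq_mul]
  linear_combination ((X i j)/2 - (Xᴴ i j)/2) * hI

lemma kraus_bounded (hK : ∑ i, (K i)ᴴ * K i = 1) (X : MatC n) :
    ∃ C : ℝ, ∀ N i j, ‖((krausMap K ^ N) X) i j‖ ≤ C := by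
  have key : ∀ Y : MatC n, ∃ C : ℝ, ∀ N i j, ‖((krausMap K ^ N) (Y * Yᴴ)) i j‖ ≤ C := by
    intro Y
    refine ⟨‖(Y * Yᴴ).trace‖, fun N i j => ?_⟩
    rw [← kraus_pow_trace hK (Y * Yᴴ) N]
    exact psd_entry_bound (kraus_pow_psd K (Matrix.posSemidef_self_mul_conjTranspose Y) N) i j
  have hsm : ∀ (c : ℂ) (Y : MatC n), (∃ C : ℝ, ∀ N i j, ‖((krausMap K ^ N) Y) i j‖ ≤ C) →
      ∃ C : ℝ, ∀ N i j, ‖((krausMap K ^ N) (c • Y)) i j‖ ≤ C := by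
    rintro c Y ⟨C, hC⟩
    refine ⟨‖c‖ * C, fun N i j => ?_⟩
    rw [map_smul, Matrix.smul_apply, norm_smul]
    exact mul_le_mul_of_nonneg_left (hC N i j) (norm_nonneg _)
  have hadd : ∀ (Y Z : MatC n), (∃ C : ℝ, ∀ N i j, ‖((krausMap K ^ N) Y) i j‖ ≤ C) →
      (∃ C : ℝ, ∀ N i j, ‖((krausMap K ^ N) Z) i j‖ ≤ C) →
      ∃ C : ℝ, ∀ N i j, ‖((krausMap K ^ N) (Y + Z)) i j‖ ≤ C := by
    rintro Y Z ⟨C, hC⟩ ⟨D, hD⟩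
    refine ⟨C + D, fun N i j => ?_⟩
    rw [map_add, Matrix.add_apply]
    exact (norm_add_le _ _).trans (add_le_add (hC N i j) (hD N i j))
  rw [polar_eq X]
  exact hadd _ _ (hadd _ _ (hadd _ _ (hsm _ _ (key _)) (hsm _ _ (key _))) (hsm _ _ (key _)))
    (hsm _ _ (key _))

lemma eq_zero_of_nat_mul_bounded {a C : ℝ} (ha : 0 ≤ a) (h : ∀ N : ℕ, N * a ≤ C) : a = 0 := by
  by_contra hne
  have hpos : 0 < a := lt_of_le_of_ne ha (Ne.symm hne)
  obtain ⟨N, hN⟩ := exists_nat_gt (C / a)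
  have := h N
  rw [div_lt_iff₀ hpos] at hN
  linarith

lemma kraus_semisimple (hK : ∑ i, (K i)ᴴ * K i = 1) {μ : ℂ} (hμ : ‖μ‖ = 1) {x y : MatC n}
    (hx : krausMap K x = μ • x + y) (hy : krausMap K y = μ • y) : y = 0 := by
  obtain ⟨C, hC⟩ := kraus_bounded hK x
  have hpow : ∀ N : ℕ, μ • (krausMap K ^ N) x = μ ^ (N + 1) • x + ((N : ℂ) * μ ^ N) • y := by
    intro N
    induction N with
    | zero => simp
    | succ N ih =>
      rw [pow_succ', Module.End.mul_apply, ← map_smul, ih, map_add, map_smul, map_smul, hx, hy]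
      push_cast
      module
  ext i j
  rw [Matrix.zero_apply, ← norm_eq_zero]
  refine eq_zero_of_nat_mul_bounded (C := C + ‖x i j‖) (norm_nonneg _) fun N => ?_
  have h1 := congrFun (congrFun (hpow N) i) j
  simp only [Matrix.add_apply, Matrix.smul_apply, smul_eq_mul] at h1
  have h2 : (N : ℂ) * μ ^ N * y i j = μ * ((krausMap K ^ N) x) i j - μ ^ (N+1) * x i j := by
    rw [h1]; ring
  have h3 := congrArg norm h2
  have h4 := norm_sub_le (μ * ((krausMap K ^ N) x) i j) (μ ^ (N+1) * x i j)
  rw [← h3] at h4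
  simp only [norm_mul, norm_pow, hμ, one_pow, mul_one, one_mul, Complex.norm_natCast] at h4
  linarith [hC N i j]

lemma maxGen_eq (hK : ∑ i, (K i)ᴴ * K i = 1) {μ : ℂ} (hμ : ‖μ‖ = 1) :
    Module.End.maxGenEigenspace (krausMap K) μ = Module.End.eigenspace (krausMap K) μ := by
  refine le_antisymm ?_ Module.End.eigenspace_le_maxGenEigenspace
  intro x hx
  rw [Module.End.mem_maxGenEigenspace] at hx
  obtain ⟨k, hk⟩ := hx
  have : ∀ (k : ℕ) (x : MatC n), ((krausMap K - μ • (1 : Module.End ℂ (MatC n))) ^ k) x = 0 →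
      krausMap K x = μ • x := by
    intro k
    induction k with
    | zero => intro x hx; simp at hx; simp [hx]
    | succ k ih =>
      intro x hx
      rw [pow_succ, Module.End.mul_apply] at hx
      have h1 := ih _ hx
      have h2 := kraus_semisimple hK hμ (x := x) (by simp) h1
      simpa [sub_eq_zero] using h2
  exact Module.End.mem_eigenspace_iff.mpr (this k x hk)

lemma psd_trace_mul_nonneg {A B : MatC n} (hA : A.PosSemidef) (hB : B.PosSemidef) :
    0 ≤ (A * B).trace := by
  obtain ⟨S, rfl⟩ := psd_factor hA
  rw [mul_assoc, Matrix.trace_mul_comm]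
  exact (hB.mul_mul_conjTranspose_same S).trace_nonneg

lemma functional_bounded (hK : ∑ i, (K i)ᴴ * K i = 1) (f : MatC n →ₗ[ℂ] ℂ) (X : MatC n) :
    ∃ C : ℝ, ∀ N, ‖f ((krausMap K ^ N) X)‖ ≤ C := by
  obtain ⟨C, hC⟩ := kraus_bounded hK X
  refine ⟨∑ i, ∑ j, C * ‖f (Matrix.single i j 1)‖, fun N => ?_⟩
  have h1 : ∀ Y : MatC n, f Y = ∑ i, ∑ j, Y i j * f (Matrix.single i j 1) := by
    intro Y
    conv_lhs => rw [Matrix.matrix_eq_sum_single Y]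
    simp only [map_sum]
    refine Finset.sum_congr rfl fun i _ => Finset.sum_congr rfl fun j _ => ?_
    rw [← smul_eq_mul, ← map_smul, Matrix.smul_single, smul_eq_mul, mul_one]
  rw [h1]
  refine (norm_sum_le _ _).trans (Finset.sum_le_sum fun i _ => ?_)
  refine (norm_sum_le _ _).trans (Finset.sum_le_sum fun j _ => ?_)
  rw [norm_mul]
  exact mul_le_mul_of_nonneg_right (hC N i j) (norm_nonneg _)

lemma mean_lower_bound (hK : ∑ i, (K i)ᴴ * K i = 1) {ρ Z : MatC n}
    (hZ : krausMap K Z = Z + (1 - ρ)) (hρ : krausMap K ρ = ρ) (f : MatC n →ₗ[ℂ] ℂ) (m : ℝ)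
    (hm : ∀ N : ℕ, m ≤ (f ((krausMap K ^ N) 1)).re) : m ≤ (f ρ).re := by
  obtain ⟨C, hC⟩ := functional_bounded hK f Z
  have hρN : ∀ N : ℕ, (krausMap K ^ N) ρ = ρ := by
    intro N
    induction N with
    | zero => simp
    | succ N ih => rw [pow_succ, Module.End.mul_apply, hρ, ih]
  have h1 : ∀ N : ℕ, N * (m - (f ρ).re) ≤ (f ((krausMap K ^ N) Z)).re - (f Z).re := by
    intro N
    induction N with
    | zero => simp
    | succ N ih =>
      have := hm N
      rw [pow_succ, Module.End.mul_apply, hZ, map_add, map_sub, hρN, map_add, map_sub,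
        Complex.add_re, Complex.sub_re]
      push_cast
      linarith
  by_contra hlt
  push Not at hlt
  have := eq_zero_of_nat_mul_bounded (a := m - (f ρ).re) (C := C - (f Z).re) (by linarith)
    (fun N => (h1 N).trans (by
      have := (Complex.re_le_norm (f ((krausMap K ^ N) Z))).trans (hC N)
      linarith))
  linarith

lemma exists_rho (hK : ∑ i, (K i)ᴴ * K i = 1)
    (hErg : Module.finrank ℂ (Module.End.eigenspace (krausMap K) 1) = 1) :
    ∃ ρ : MatC n, ρ.PosSemidef ∧ krausMap K ρ = ρ ∧
      (∀ X, krausMap K X = X → ∃ c : ℂ, X = c • ρ) ∧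
      (∀ Y : MatC n, Y.PosSemidef → (krausDual K Y - Y).PosSemidef → (ρ * Y).trace = 0 → Y = 0) := by
  set T : MatC n →ₗ[ℂ] MatC n := krausMap K - 1 with hT
  have hTa : ∀ x, T x = krausMap K x - x := fun x => by simp [hT]
  have hdisj : Disjoint (LinearMap.range T) (LinearMap.ker T) := by
    rw [Submodule.disjoint_def]
    rintro x ⟨z, hz⟩ hx
    rw [LinearMap.mem_ker, hTa, sub_eq_zero] at hx
    rw [hTa] at hz
    refine kraus_semisimple hK (μ := 1) (by simp) (x := z) ?_ (by simpa using hx)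
    rw [← hz]; simp
  have htop := Submodule.eq_top_of_disjoint _ _ (LinearMap.finrank_range_add_finrank_ker T).ge hdisj
  have h1 : (1 : MatC n) ∈ LinearMap.range T ⊔ LinearMap.ker T := by rw [htop]; trivial
  obtain ⟨w, ⟨z, hz⟩, v, hv, hwv⟩ := Submodule.mem_sup.mp h1
  rw [LinearMap.mem_ker, hTa, sub_eq_zero] at hv
  rw [hTa] at hz
  -- symmetrise
  have hvs : krausMap K vᴴ = vᴴ := by rw [kraus_star, hv]
  have hzv : krausMap K z = z + (1 - v) := by rw [← hwv, ← hz]; abel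
  set ρ : MatC n := (1/2 : ℂ) • (v + vᴴ) with hρdef
  set Z : MatC n := (1/2 : ℂ) • (z + zᴴ) with hZdef
  have hρ : krausMap K ρ = ρ := by rw [hρdef, map_smul, map_add, hv, hvs]
  have hZ : krausMap K Z = Z + (1 - ρ) := by
    rw [hZdef, map_smul, map_add, kraus_star, hzv]
    simp only [Matrix.conjTranspose_add, Matrix.conjTranspose_sub, Matrix.conjTranspose_one, hρdef]
    module
  have hH : ρ.IsHermitian := by
    simp [Matrix.IsHermitian, hρdef, add_comm]
  have hpsd : ρ.PosSemidef := by
    refine Matrix.PosSemidef.of_dotProduct_mulVec_nonneg hH fun x => ?_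
    rw [Complex.nonneg_iff]
    refine ⟨?_, (hH.im_star_dotProduct_mulVec_self x).symm⟩
    let f : MatC n →ₗ[ℂ] ℂ :=
      { toFun := fun X => star x ⬝ᵥ X *ᵥ x
        map_add' := fun X Y => by rw [Matrix.add_mulVec, dotProduct_add]
        map_smul' := fun c X => by rw [Matrix.smul_mulVec, dotProduct_smul]; rfl }
    exact mean_lower_bound hK hZ hρ f 0 fun N =>
      (Complex.nonneg_iff.mp ((kraus_pow_psd K Matrix.PosSemidef.one N).dotProduct_mulVec_nonneg x)).1
  have htr : ρ.trace = (1 : MatC n).trace := by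
    have := congrArg Matrix.trace hZ
    rw [kraus_trace hK, Matrix.trace_add, Matrix.trace_sub] at this
    linear_combination this
  obtain ⟨⟨r, hr⟩, hr0, hrall⟩ := finrank_eq_one_iff'.mp hErg
  have hfix : ∀ X, krausMap K X = X → ∃ c : ℂ, c • r = X := by
    intro X hX
    obtain ⟨c, hc⟩ := hrall ⟨X, Module.End.mem_eigenspace_iff.mpr (by simpa using hX)⟩
    exact ⟨c, congrArg Subtype.val hc⟩
  have hρ0 : ρ ≠ 0 := by
    intro h0
    rw [h0, Matrix.trace_zero] at htr
    have h1 : (1 : MatC n) = 0 := (Matrix.PosSemidef.one.trace_eq_zero_iff).mp htr.symm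
    have hr1 : r = 0 := by rw [← mul_one r, h1, mul_zero]
    exact hr0 (Subtype.ext hr1)
  obtain ⟨a, ha⟩ := hfix ρ hρ
  have ha0 : a ≠ 0 := by rintro rfl; exact hρ0 (by rw [← ha, zero_smul])
  refine ⟨ρ, hpsd, hρ, ?_, ?_⟩
  · intro X hX
    obtain ⟨c, hc⟩ := hfix X hX
    refine ⟨c / a, ?_⟩
    rw [← ha, smul_smul, div_mul_cancel₀ _ ha0, hc]
  · intro Y hY hY2 h0
    let f : MatC n →ₗ[ℂ] ℂ :=
      { toFun := fun X => (X * Y).trace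
        map_add' := fun X Z => by rw [add_mul, Matrix.trace_add]
        map_smul' := fun c X => by rw [Matrix.smul_mul, Matrix.trace_smul]; rfl }
    have hmono : ∀ N : ℕ, Y.trace.re ≤ (f ((krausMap K ^ N) 1)).re := by
      intro N
      induction N with
      | zero => simp [f]
      | succ N ih =>
        refine ih.trans ?_
        have h2 := psd_trace_mul_nonneg (kraus_pow_psd K Matrix.PosSemidef.one N) hY2
        rw [mul_sub, Matrix.trace_sub, ← trace_kraus_dual, Complex.nonneg_iff, Complex.sub_re] at h2
        rw [pow_succ', Module.End.mul_apply]
        exact sub_nonneg.mp h2.1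
    have h3 := mean_lower_bound hK hZ hρ f _ hmono
    have h4 : (f ρ).re = 0 := by change (ρ * Y).trace.re = 0; rw [h0]; rfl
    have h5 := Complex.nonneg_iff.mp hY.trace_nonneg
    apply hY.trace_eq_zero_iff.mp
    apply Complex.ext
    · simp; linarith
    · simpa using h5.2.symm

lemma mul_eq_zero_of_mul_psd {R : MatC n} (hR : R.PosSemidef) (D U : MatC n) (c : ℂ)
    (hU : U * R * Uᴴ = c • R) (hD : D * R = 0) : D * (U * R) = 0 := by
  obtain ⟨B, hB⟩ := psd_factor hR
  have hR' : R = Bᴴ * (Bᴴ)ᴴ := by rw [hB, Matrix.conjTranspose_conjTranspose]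
  have h1 : (D * U * Bᴴ) * (D * U * Bᴴ)ᴴ = 0 := by
    have : (D * U * Bᴴ) * (D * U * Bᴴ)ᴴ = D * (U * R * Uᴴ) * Dᴴ := by
      rw [hB]; simp only [Matrix.conjTranspose_mul, Matrix.conjTranspose_conjTranspose, mul_assoc]
    rw [this, hU, Matrix.mul_smul, hD, smul_zero, zero_mul]
  have h2 := Matrix.self_mul_conjTranspose_eq_zero.mp h1
  rw [hB, ← mul_assoc, ← mul_assoc, h2, zero_mul]

lemma schwarz_eq (hK : ∑ i, (K i)ᴴ * K i = 1) {μ : ℂ} (hμ : ‖μ‖ = 1) {U : MatC n}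
    (hU : krausDual K U = μ • U) :
    krausDual K (Uᴴ * U) - Uᴴ * U =
      ∑ i, (U * K i - μ • (K i * U))ᴴ * (U * K i - μ • (K i * U)) := by
  have hμ2 : μ * star μ = 1 := by
    rw [Complex.star_def, Complex.mul_conj']; simp [hμ]
  have hUs : krausDual K Uᴴ = star μ • Uᴴ := by
    rw [krausDual_star, hU, Matrix.conjTranspose_smul]
  have hexp : ∀ i, (U * K i - μ • (K i * U))ᴴ * (U * K i - μ • (K i * U)) =
      (K i)ᴴ * (Uᴴ * U) * K i - μ • (((K i)ᴴ * Uᴴ * K i) * U)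
        - star μ • (Uᴴ * ((K i)ᴴ * U * K i)) + (μ * star μ) • (Uᴴ * ((K i)ᴴ * K i) * U) := by
    intro i
    simp only [Matrix.conjTranspose_sub, Matrix.conjTranspose_smul, Matrix.conjTranspose_mul,
      sub_mul, mul_sub, Matrix.smul_mul, Matrix.mul_smul, smul_smul, mul_assoc]
    module
  simp only [hexp, Finset.sum_add_distrib, Finset.sum_sub_distrib, ← Finset.smul_sum,
    ← Finset.sum_mul, ← Finset.mul_sum]
  rw [← krausDual_apply, ← krausDual_apply, ← krausDual_apply, hK, hU, hUs]
  simp only [Matrix.smul_mul, Matrix.mul_smul, smul_smul, mul_one]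
  rw [hμ2, mul_comm (star μ), hμ2]
  module

/-- Bundled facts about the invariant state. -/
structure GoodState (K : ι → MatC n) (ρ : MatC n) : Prop where
  hK : ∑ i, (K i)ᴴ * K i = 1
  psd : ρ.PosSemidef
  fix : krausMap K ρ = ρ
  uniq : ∀ X, krausMap K X = X → ∃ c : ℂ, X = c • ρ
  faith : ∀ Y : MatC n, Y.PosSemidef → (krausDual K Y - Y).PosSemidef → (ρ * Y).trace = 0 → Y = 0

variable {ρ : MatC n}

lemma GoodState.commute (G : GoodState K ρ) {μ : ℂ} (hμ : ‖μ‖ = 1) {U : MatC n}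
    (hU : krausDual K U = μ • U) (i : ι) : (U * K i - μ • (K i * U)) * ρ = 0 := by
  have h := schwarz_eq G.hK hμ hU
  have h1 : (ρ * (krausDual K (Uᴴ * U) - Uᴴ * U)).trace = 0 := by
    rw [mul_sub, Matrix.trace_sub, ← trace_kraus_dual, G.fix, sub_self]
  rw [h, Finset.mul_sum, Matrix.trace_sum, Finset.sum_eq_zero_iff_of_nonneg] at h1
  · have h2 := h1 i (Finset.mem_univ i)
    set D := U * K i - μ • (K i * U)
    obtain ⟨B, hB⟩ := psd_factor G.psd
    rw [hB, mul_assoc, Matrix.trace_mul_comm] at h2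
    have h3 : (D * Bᴴ)ᴴ * (D * Bᴴ) = B * (Dᴴ * D) * Bᴴ := by
      simp only [Matrix.conjTranspose_mul, Matrix.conjTranspose_conjTranspose, mul_assoc]
    rw [← h3] at h2
    have h4 := Matrix.trace_conjTranspose_mul_self_eq_zero_iff.mp h2
    rw [hB, ← mul_assoc, h4, zero_mul]
  · intro j _
    exact psd_trace_mul_nonneg G.psd (Matrix.posSemidef_conjTranspose_mul_self _)

lemma GoodState.commute' (G : GoodState K ρ) {μ : ℂ} (hμ : ‖μ‖ = 1) {U : MatC n}
    (hU : krausDual K U = μ • U) (i : ι) : K i * U * ρ = star μ • (U * K i * ρ) := by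
  have h := G.commute hμ hU i
  rw [sub_mul, sub_eq_zero, Matrix.smul_mul] at h
  rw [h, smul_smul]
  have hμ2 : star μ * μ = 1 := by
    rw [Complex.star_def, Complex.conj_mul']; simp [hμ]
  rw [hμ2, one_smul]

lemma GoodState.nonvanish (G : GoodState K ρ) {μ : ℂ} (hμ : ‖μ‖ = 1) {U : MatC n}
    (hU : krausDual K U = μ • U) (h0 : U * ρ = 0) : U = 0 := by
  have := G.faith (Uᴴ * U) (Matrix.posSemidef_conjTranspose_mul_self _) (by
    rw [schwarz_eq G.hK hμ hU]
    exact Matrix.posSemidef_sum _ fun i _ => Matrix.posSemidef_conjTranspose_mul_self _)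
    (by rw [Matrix.trace_mul_comm, mul_assoc, h0, mul_zero, Matrix.trace_zero])
  exact Matrix.conjTranspose_mul_self_eq_zero.mp this

lemma GoodState.sandwich (G : GoodState K ρ) {μ : ℂ} (hμ : ‖μ‖ = 1) {U : MatC n}
    (hU : krausDual K U = μ • U) : ∃ c : ℂ, U * ρ * Uᴴ = c • ρ := by
  apply G.uniq
  obtain ⟨B, hB⟩ := psd_factor G.psd
  have hc : ∀ i, K i * U * Bᴴ = star μ • (U * K i * Bᴴ) := by
    intro i
    have h := G.commute hμ hU i
    have h2 : (U * K i - μ • (K i * U)) * Bᴴ = 0 := by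
      rw [hB] at h
      have := (Matrix.mul_self_mul_conjTranspose_eq_zero Bᴴ (U * K i - μ • (K i * U))).mp
        (by rwa [Matrix.conjTranspose_conjTranspose])
      exact this
    rw [sub_mul, sub_eq_zero, Matrix.smul_mul] at h2
    have hμ2 : star μ * μ = 1 := by
      rw [Complex.star_def, Complex.conj_mul']; simp [hμ]
    rw [h2, smul_smul, hμ2, one_smul]
  have hμ2 : star μ * μ = 1 := by
    rw [Complex.star_def, Complex.conj_mul']; simp [hμ]
  conv_rhs => rw [← G.fix]
  rw [krausMap_apply, krausMap_apply, Finset.mul_sum, Finset.sum_mul]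
  refine Finset.sum_congr rfl fun i _ => ?_
  calc K i * (U * ρ * Uᴴ) * (K i)ᴴ = (K i * U * Bᴴ) * (K i * U * Bᴴ)ᴴ := by
        rw [hB]
        simp only [Matrix.conjTranspose_mul, Matrix.conjTranspose_conjTranspose, mul_assoc]
    _ = (U * K i * Bᴴ) * (U * K i * Bᴴ)ᴴ := by
        rw [hc, Matrix.conjTranspose_smul, Matrix.smul_mul, Matrix.mul_smul, smul_smul, star_star,
          hμ2, one_smul]
    _ = _ := by
        rw [hB]
        simp only [Matrix.conjTranspose_mul, Matrix.conjTranspose_conjTranspose, mul_assoc]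

lemma GoodState.push (G : GoodState K ρ) {ν : ℂ} (hν : ‖ν‖ = 1) {V D : MatC n}
    (hV : krausDual K V = ν • V) (hD : D * ρ = 0) : D * (V * ρ) = 0 := by
  obtain ⟨c, hc⟩ := G.sandwich hν hV
  exact mul_eq_zero_of_mul_psd G.psd D V c hc hD

lemma GoodState.eigen_mul (G : GoodState K ρ) {μ ν : ℂ} (hμ : ‖μ‖ = 1) (hν : ‖ν‖ = 1) {U V : MatC n}
    (hU : krausDual K U = μ • U) (hV : krausDual K V = ν • V) :
    krausMap K (U * V * ρ) = (star μ * star ν) • (U * V * ρ) := by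
  have hμ2 : star μ * μ = 1 := by
    rw [Complex.star_def, Complex.conj_mul']; simp [hμ]
  have hc : ∀ i, K i * (U * V * ρ) = (star μ * star ν) • (U * V * K i * ρ) := by
    intro i
    have h := G.push hν hV (G.commute hμ hU i)
    rw [sub_mul, sub_eq_zero, Matrix.smul_mul] at h
    have h2 : K i * (U * V * ρ) = star μ • (U * K i * (V * ρ)) := by
      rw [h, smul_smul, hμ2, one_smul]; simp only [mul_assoc]
    have h3 := G.commute' hν hV i
    rw [h2, show U * K i * (V * ρ) = U * (K i * V * ρ) by simp only [mul_assoc], h3,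
      Matrix.mul_smul, smul_smul]
    simp only [mul_assoc]
  conv_rhs => rw [← G.fix]
  rw [krausMap_apply, krausMap_apply, Finset.mul_sum, Finset.smul_sum]
  refine Finset.sum_congr rfl fun i _ => ?_
  rw [hc, Matrix.smul_mul]
  simp only [mul_assoc]

lemma GoodState.star_mul (G : GoodState K ρ) {μ : ℂ} (hμ : ‖μ‖ = 1) {U V : MatC n}
    (hU : krausDual K U = μ • U) (hV : krausDual K V = μ • V) :
    ∃ c : ℂ, Uᴴ * V * ρ = c • ρ := by
  have hUs : krausDual K Uᴴ = star μ • Uᴴ := by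
    rw [krausDual_star, hU, Matrix.conjTranspose_smul]
  apply G.uniq
  rw [G.eigen_mul (by simpa using hμ) hμ hUs hV, star_star]
  have hμ2 : μ * star μ = 1 := by
    rw [Complex.star_def, Complex.mul_conj']; simp [hμ]
  rw [hμ2, one_smul]

lemma GoodState.star_mul_self (G : GoodState K ρ) {μ : ℂ} (hμ : ‖μ‖ = 1) {U : MatC n}
    (hU : krausDual K U = μ • U) (h0 : U ≠ 0) :
    ∃ c : ℂ, c ≠ 0 ∧ Uᴴ * U * ρ = c • ρ := by
  obtain ⟨c, hc⟩ := G.star_mul hμ hU hU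
  refine ⟨c, ?_, hc⟩
  rintro rfl
  rw [zero_smul, mul_assoc] at hc
  apply h0
  apply G.nonvanish hμ hU
  rw [← Matrix.conjTranspose_mul_self_eq_zero, Matrix.conjTranspose_mul, mul_assoc, hc, mul_zero]

lemma GoodState.mul_ne_zero (G : GoodState K ρ) {μ ν : ℂ} (hμ : ‖μ‖ = 1) (hν : ‖ν‖ = 1) {U V : MatC n}
    (hU : krausDual K U = μ • U) (hV : krausDual K V = ν • V) (hU0 : U ≠ 0) (hV0 : V ≠ 0) :
    U * V * ρ ≠ 0 := by
  intro h
  obtain ⟨c, hc0, hc⟩ := G.star_mul_self hμ hU hU0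
  have h1 : (Uᴴ * U - c • 1) * ρ = 0 := by rw [sub_mul, hc]; simp
  have h2 := G.push hν hV h1
  rw [sub_mul, show Uᴴ * U * (V * ρ) = Uᴴ * (U * V * ρ) by simp only [mul_assoc], h] at h2
  simp only [mul_zero, zero_sub, Matrix.smul_mul, one_mul, neg_eq_zero] at h2
  exact hV0 (G.nonvanish hν hV ((smul_eq_zero.mp h2).resolve_left hc0))

lemma GoodState.unique (G : GoodState K ρ) {μ : ℂ} (hμ : ‖μ‖ = 1) {U V : MatC n}
    (hU : krausDual K U = μ • U) (hV : krausDual K V = μ • V) (hU0 : U ≠ 0) :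
    ∃ a : ℂ, a • U = V := by
  have hUs : krausDual K Uᴴ = star μ • Uᴴ := by
    rw [krausDual_star, hU, Matrix.conjTranspose_smul]
  obtain ⟨a, ha⟩ := G.star_mul hμ hU hV
  obtain ⟨c, hc0, hc⟩ := G.star_mul_self (by simpa using hμ) hUs
    (by simpa using hU0)
  rw [Matrix.conjTranspose_conjTranspose] at hc
  have h1 : (U * Uᴴ - c • 1) * ρ = 0 := by rw [sub_mul, hc]; simp
  have h2 := G.push hμ hV h1
  rw [sub_mul, show U * Uᴴ * (V * ρ) = U * (Uᴴ * V * ρ) by simp only [mul_assoc], ha] at h2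
  have h3 : (a • U - c • V) * ρ = 0 := by
    rw [sub_mul, ← h2]; simp
  have h4 : a • U - c • V = 0 := by
    apply G.nonvanish hμ _ h3
    rw [map_sub, map_smul, map_smul, hU, hV]
    module
  refine ⟨c⁻¹ * a, ?_⟩
  rw [mul_smul, sub_eq_zero.mp h4, smul_smul, inv_mul_cancel₀ hc0, one_smul]

lemma finrank_dual_eq (μ : ℂ) :
    Module.finrank ℂ (Module.End.eigenspace (krausDual K) μ) =
      Module.finrank ℂ (Module.End.eigenspace (krausMap K) μ) := by
  let τ : MatC n →ₗ[ℂ] Module.Dual ℂ (MatC n) := LinearMap.mk₂ ℂ (fun Y X => (X * Y).trace)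
    (by intros; simp [mul_add]) (by intros; simp) (by intros; simp [add_mul]) (by intros; simp)
  have hτ : ∀ Y X, τ Y X = (X * Y).trace := fun _ _ => rfl
  have hinj : Function.Injective τ := by
    intro A B h
    apply Matrix.ext_iff_trace_mul_left.mpr
    intro X
    exact congrArg (fun g => g X) h
  have hsurj : Function.Surjective τ :=
    (LinearMap.injective_iff_surjective_of_finrank_eq_finrank
      (Subspace.dual_finrank_eq).symm).mp hinj
  let f : MatC n →ₗ[ℂ] MatC n := krausMap K - μ • 1
  let g : MatC n →ₗ[ℂ] MatC n := krausDual K - μ • 1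
  have hfg : f.dualMap ∘ₗ τ = τ ∘ₗ g := by
    refine LinearMap.ext fun Y => LinearMap.ext fun X => ?_
    simp only [LinearMap.comp_apply, LinearMap.dualMap_apply, hτ, f, g, LinearMap.sub_apply,
      LinearMap.smul_apply, Module.End.one_apply, sub_mul, mul_sub, Matrix.trace_sub,
      trace_kraus_dual, Matrix.smul_mul, Matrix.mul_smul]
  have hr : Module.finrank ℂ (LinearMap.range g) = Module.finrank ℂ (LinearMap.range f) := by
    have h1 : Module.finrank ℂ (LinearMap.range (τ ∘ₗ g)) = Module.finrank ℂ (LinearMap.range g) := by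
      rw [LinearMap.range_comp]
      exact (LinearEquiv.finrank_eq (Submodule.equivMapOfInjective τ hinj _)).symm
    have h2 : LinearMap.range (f.dualMap ∘ₗ τ) = LinearMap.range f.dualMap := by
      apply LinearMap.range_comp_of_range_eq_top
      rw [LinearMap.range_eq_top]
      exact hsurj
    rw [← h1, ← hfg, h2, LinearMap.finrank_range_dualMap_eq_finrank_range]
  have h3 := LinearMap.finrank_range_add_finrank_ker g
  have h4 := LinearMap.finrank_range_add_finrank_ker f
  rw [Module.End.eigenspace_def, Module.End.eigenspace_def]
  change Module.finrank ℂ (LinearMap.ker g) = Module.finrank ℂ (LinearMap.ker f)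
  omega

lemma hasEigenvalue_dual_iff (μ : ℂ) :
    Module.End.HasEigenvalue (krausMap K) μ ↔ Module.End.HasEigenvalue (krausDual K) μ := by
  have h := finrank_dual_eq (K := K) μ
  rw [Module.End.hasEigenvalue_iff, Module.End.hasEigenvalue_iff, ← Submodule.one_le_finrank_iff,
    ← Submodule.one_le_finrank_iff, h]

lemma hasEigenvalue_star {μ : ℂ} (h : Module.End.HasEigenvalue (krausMap K) μ) :
    Module.End.HasEigenvalue (krausMap K) (star μ) := by
  obtain ⟨x, hx⟩ := h.exists_hasEigenvector
  refine Module.End.hasEigenvalue_of_hasEigenvector (x := xᴴ) ⟨?_, ?_⟩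
  · rw [Module.End.mem_eigenspace_iff, kraus_star, hx.apply_eq_smul, Matrix.conjTranspose_smul]
  · simpa using hx.2

lemma GoodState.hasEigenvalue_mul (G : GoodState K ρ) {μ ν : ℂ} (hμ : ‖μ‖ = 1) (hν : ‖ν‖ = 1)
    (h1 : Module.End.HasEigenvalue (krausMap K) μ) (h2 : Module.End.HasEigenvalue (krausMap K) ν) :
    Module.End.HasEigenvalue (krausMap K) (μ * ν) := by
  obtain ⟨U, hU⟩ := ((hasEigenvalue_dual_iff μ).mp h1).exists_hasEigenvector
  obtain ⟨V, hV⟩ := ((hasEigenvalue_dual_iff ν).mp h2).exists_hasEigenvector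
  have h3 : Module.End.HasEigenvalue (krausMap K) (star μ * star ν) :=
    Module.End.hasEigenvalue_of_hasEigenvector (x := U * V * ρ)
      ⟨Module.End.mem_eigenspace_iff.mpr
        (G.eigen_mul hμ hν hU.apply_eq_smul hV.apply_eq_smul),
      G.mul_ne_zero hμ hν hU.apply_eq_smul hV.apply_eq_smul hU.2 hV.2⟩
  simpa using hasEigenvalue_star h3

lemma GoodState.finrank_one (G : GoodState K ρ) {μ : ℂ} (hμ : ‖μ‖ = 1)
    (h1 : Module.End.HasEigenvalue (krausMap K) μ) :
    Module.finrank ℂ (Module.End.eigenspace (krausMap K) μ) = 1 := by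
  rw [← finrank_dual_eq]
  obtain ⟨U, hU⟩ := ((hasEigenvalue_dual_iff μ).mp h1).exists_hasEigenvector
  rw [finrank_eq_one_iff']
  refine ⟨⟨U, hU.1⟩, fun h => hU.2 (congrArg Subtype.val h), ?_⟩
  rintro ⟨V, hV⟩
  obtain ⟨a, ha⟩ := G.unique hμ hU.apply_eq_smul (Module.End.mem_eigenspace_iff.mp hV) hU.2
  exact ⟨a, Subtype.ext ha⟩

end helpers

lemma finite_group_roots (S : Set ℂ) (hfin : S.Finite) (hnorm : ∀ z ∈ S, ‖z‖ = 1) (h1 : (1 : ℂ) ∈ S)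
    (hmul : ∀ z ∈ S, ∀ w ∈ S, z * w ∈ S) (hstar : ∀ z ∈ S, star z ∈ S) :
    ∃ K : ℕ, 1 ≤ K ∧ S = {μ : ℂ | ∃ ℓ : Fin K,
      μ = Complex.exp (2 * (Real.pi : ℂ) * Complex.I * ((ℓ : ℕ) : ℂ) / ((K : ℕ) : ℂ))} := by
  have hinv : ∀ z ∈ S, z⁻¹ = star z := by
    intro z hz
    apply inv_eq_of_mul_eq_one_left
    rw [Complex.star_def, Complex.conj_mul']; simp [hnorm z hz]
  let H : Subgroup ℂˣ :=
    { carrier := {u | (u : ℂ) ∈ S}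
      mul_mem' := fun {a b} ha hb => by simpa using hmul _ ha _ hb
      one_mem' := by simpa using h1
      inv_mem' := fun {a} ha => by
        change ((a⁻¹ : ℂˣ) : ℂ) ∈ S
        rw [Units.val_inv_eq_inv_val, hinv _ ha]
        exact hstar _ ha }
  have hH : ∀ u : ℂˣ, u ∈ H ↔ (u : ℂ) ∈ S := fun _ => Iff.rfl
  have hHfin : (H : Set ℂˣ).Finite := 
    Set.Finite.preimage (f := (Units.val : ℂˣ → ℂ)) (Units.val_injective.injOn) hfin
  have : Finite H := hHfin.to_subtype
  have hpos : 0 < Nat.card H := Nat.card_pos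
  have : NeZero (Nat.card H) := ⟨hpos.ne'⟩
  have hle : H ≤ rootsOfUnity (Nat.card H) ℂ := by
    intro u hu
    rw [mem_rootsOfUnity]
    have := pow_card_eq_one' (G := H) (x := ⟨u, hu⟩)
    exact congrArg Subtype.val this
  have heq : H = rootsOfUnity (Nat.card H) ℂ :=
    Subgroup.eq_of_le_of_card_ge hle (Complex.card_rootsOfUnity _).le
  refine ⟨Nat.card H, hpos, ?_⟩
  have hroots : ∀ u : ℂˣ, (u : ℂ) ∈ S ↔ ∃ i < Nat.card H,
      Complex.exp (2 * (Real.pi : ℂ) * Complex.I * ((i : ℂ) / ((Nat.card H : ℕ) : ℂ))) = u := by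
    intro u
    rw [← Complex.mem_rootsOfUnity, ← heq, hH]
  ext z
  constructor
  · intro hz
    have hz0 : z ≠ 0 := by
      rintro rfl
      simpa using hnorm 0 hz
    obtain ⟨i, hi, h⟩ := (hroots (Units.mk0 z hz0)).mp hz
    refine ⟨⟨i, hi⟩, ?_⟩
    rw [Units.val_mk0] at h
    rw [← h, mul_div_assoc]
  · rintro ⟨ℓ, rfl⟩
    refine (hroots (Units.mk0 _ (Complex.exp_ne_zero _))).mpr ⟨ℓ, ℓ.2, ?_⟩
    rw [Units.val_mk0, mul_div_assoc]

/-- **Spectral structure of an ergodic quantum channel (part 1).**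
The peripheral spectrum of an ergodic quantum channel is exactly the set of `K`-th roots
of unity for some `K ≥ 1`, and every peripheral eigenvalue has algebraic multiplicity `1`. -/
theorem ergodic_peripheral_spectrum {n : ℕ} (E : MatC n →ₗ[ℂ] MatC n)
    (hE : IsQuantumChannel E) (hErg : IsErgodic E) :
    ∃ K : ℕ, 1 ≤ K ∧
      ({μ : ℂ | Module.End.HasEigenvalue E μ ∧ ‖μ‖ = 1}
        = {μ : ℂ | ∃ ℓ : Fin K,
            μ = Complex.exp (2 * (Real.pi : ℂ) * Complex.I * ((ℓ : ℕ) : ℂ) / ((K : ℕ) : ℂ))}) ∧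
      (∀ μ : ℂ, Module.End.HasEigenvalue E μ → ‖μ‖ = 1 →
        Module.finrank ℂ (Module.End.maxGenEigenspace E μ) = 1) := by
  obtain ⟨K, rfl, hK⟩ := exists_kraus E hE
  obtain ⟨ρ, h1, h2, h3, h4⟩ := exists_rho hK hErg
  have G : GoodState K ρ := ⟨hK, h1, h2, h3, h4⟩
  obtain ⟨k, hk, hS⟩ := finite_group_roots
    {μ : ℂ | Module.End.HasEigenvalue (krausMap K) μ ∧ ‖μ‖ = 1}
    ((Module.End.finite_hasEigenvalue (krausMap K)).subset fun _ h => h.1)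
    (fun _ h => h.2)
    ⟨by
      rw [Module.End.hasEigenvalue_iff, ← Submodule.one_le_finrank_iff]
      exact hErg.ge, by simp⟩
    (fun z hz w hw => ⟨G.hasEigenvalue_mul hz.2 hw.2 hz.1 hw.1, by simp [hz.2, hw.2]⟩)
    (fun z hz => ⟨hasEigenvalue_star hz.1, by simpa using hz.2⟩)
  refine ⟨k, hk, hS, fun μ hμ hn => ?_⟩
  rw [maxGen_eq hK hn]
  exact G.finrank_one hn hμ
end
end

section
/- Let 𝓔 : B(ℋ) → B(ℋ) be a quantum channel that admits no decoherence-free subsystem (i.e. all blocks in the structure decomposition of its space of recurrences have d_k = 1), and suppose at least one peripheral eigenvalue of 𝓔 has algebraic multiplicity strictly larger than 1 (so 𝓔 is not ergodic). Then the permutation π in the structure decomposition splits into disjoint cycles c of lengths K_c, the space of recurrences decomposes accordingly as X(𝓔) = ⊕_c X_c with each X_c invariant under 𝓔, and 𝓔 restricted to each X_c acts as an ergodic quantum channel 𝓔_c whose peripheral spectrum is {e^{2πim/K_c} : m = 0, …, K_c−1} without degeneracy; in particular 𝓔(X) = ⊕_c 𝓔_c(X) for every X ∈ X(𝓔). -/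
open Matrix Kronecker
open scoped ComplexOrder
noncomputable section

def recSpace {n : ℕ} (E : MatC n →ₗ[ℂ] MatC n) : Submodule ℂ (MatC n) :=
  ⨆ μ ∈ {μ : ℂ | ‖μ‖ = 1}, Module.End.eigenspace E μ

/-- The structure decomposition of the space of recurrences of a quantum channel
(Wolf, Theorems 6.14 and 6.16): `X(𝓔) = 0 ⊕ ⊕ₖ M_{d_k} ⊗ ρ_k`, on which `𝓔` acts by
unitary conjugations `U_k` together with a permutation `π` of sub-blocks of equal
dimension.  The `k`-th block `ℋ_{k,1} ⊗ ℋ_{k,2}` is embedded into `ℋ` by the isometry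
`V_k`, with mutually orthogonal ranges.  A decoherence-free subsystem is a block
with `d_k ≥ 2`. -/
structure PeripheralDecomposition {n : ℕ} (E : MatC n →ₗ[ℂ] MatC n) where
  K : ℕ
  d : Fin K → ℕ
  m : Fin K → ℕ
  hd : ∀ k, 0 < d k
  hm : ∀ k, 0 < m k
  V : (k : Fin K) → Matrix (Fin n) (Fin (d k) × Fin (m k)) ℂ
  ρ : (k : Fin K) → Matrix (Fin (m k)) (Fin (m k)) ℂ
  U : (k : Fin K) → Matrix (Fin (d k)) (Fin (d k)) ℂ
  perm : Equiv.Perm (Fin K)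
  hperm : ∀ k, d (perm k) = d k
  hViso : ∀ k, (V k)ᴴ * V k = 1
  hVorth : ∀ k j, k ≠ j → (V k)ᴴ * V j = 0
  hρpos : ∀ k, (ρ k).PosDef
  hρtr : ∀ k, (ρ k).trace = 1
  hU : ∀ k, U k ∈ Matrix.unitaryGroup (Fin (d k)) ℂ
  hX : ∀ A : MatC n, A ∈ recSpace E ↔
    ∃ x : (k : Fin K) → Matrix (Fin (d k)) (Fin (d k)) ℂ,
      A = ∑ k, V k * (x k ⊗ₖ ρ k) * (V k)ᴴ
  hact : ∀ x : (k : Fin K) → Matrix (Fin (d k)) (Fin (d k)) ℂ,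
    E (∑ k, V k * (x k ⊗ₖ ρ k) * (V k)ᴴ)
      = ∑ k, V k *
          ((U k * (Matrix.reindex (finCongr (hperm k)) (finCongr (hperm k)) (x (perm k))) * (U k)ᴴ)
            ⊗ₖ ρ k) * (V k)ᴴ

/-- The sub-block of the space of recurrences associated with the cycle of `π`
containing the block index `k`. -/
def cycleBlock {n : ℕ} {E : MatC n →ₗ[ℂ] MatC n} (D : PeripheralDecomposition E)
    (k : Fin D.K) : Submodule ℂ (MatC n) :=
  Submodule.span ℂ {A | ∃ j, D.perm.SameCycle k j ∧
    ∃ x : Matrix (Fin (D.d j)) (Fin (D.d j)) ℂ, A = D.V j * (x ⊗ₖ D.ρ j) * (D.V j)ᴴ}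


/-- measure-and-prepare map attached to a set of blocks -/
def mpMap {n K : ℕ} (Q σ : Fin K → MatC n) (p : Equiv.Perm (Fin K)) (c : Finset (Fin K)) :
    MatC n →ₗ[ℂ] MatC n :=
  ∑ j ∈ c, ((Matrix.traceLinearMap (Fin n) ℂ ℂ).comp (LinearMap.mulLeft ℂ (Q (p j)))).smulRight (σ j)

theorem mpMap_apply {n K : ℕ} (Q σ : Fin K → MatC n) (p : Equiv.Perm (Fin K)) (c : Finset (Fin K))
    (A : MatC n) : mpMap Q σ p c A = ∑ j ∈ c, (Q (p j) * A).trace • σ j := by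
  simp [mpMap, LinearMap.sum_apply]

theorem mpMap_channel {n K : ℕ} (Q σ : Fin K → MatC n) (p : Equiv.Perm (Fin K))
    (c : Finset (Fin K)) (hp : ∀ j, p j ∈ c ↔ j ∈ c)
    (hQ : ∀ j, (Q j).PosSemidef) (hσ : ∀ j, (σ j).PosSemidef) (hσt : ∀ j, (σ j).trace = 1)
    (hsum : ∑ j ∈ c, Q j = 1) : IsQuantumChannel (mpMap Q σ p c) := by
  constructor
  · have : choi (mpMap Q σ p c) = ∑ j ∈ c, (σ j) ⊗ₖ (Q (p j))ᵀ := by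
      ext a b
      simp only [choi, mpMap_apply, Matrix.sum_apply, Matrix.smul_apply, smul_eq_mul,
        Matrix.kroneckerMap_apply, Matrix.transpose_apply, Matrix.trace_mul_single]
      refine Finset.sum_congr rfl fun j _ => ?_
      simp [mul_comm]
    rw [this]
    exact Matrix.posSemidef_sum _ fun j _ => (hσ j).kronecker (hQ _).transpose
  · intro A
    rw [mpMap_apply, Matrix.trace_sum]
    simp only [Matrix.trace_smul, hσt, smul_eq_mul, mul_one]
    have : ∑ j ∈ c, (Q (p j) * A).trace = ∑ j ∈ c, (Q j * A).trace :=
      Finset.sum_equiv p (fun j => (hp j).symm) (fun j _ => rfl)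
    rw [this, ← Matrix.trace_sum, ← Finset.sum_mul, hsum, one_mul]

theorem mpMap_coord {n K : ℕ} (Q σ : Fin K → MatC n) (p : Equiv.Perm (Fin K))
    (c : Finset (Fin K))
    (hd : ∀ i ∈ c, ∀ j ∈ c, (Q i * σ j).trace = if i = j then 1 else 0)
    (A : MatC n) (j : Fin K) (hj : j ∈ c) :
    (Q j * mpMap Q σ p c A).trace = (Q (p j) * A).trace := by
  rw [mpMap_apply, Finset.mul_sum, Matrix.trace_sum, Finset.sum_eq_single j]
  · simp [hd j hj j hj]
  · intro b hb hne
    simp [hd j hj b hb, hne.symm]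
  · intro h; exact absurd hj h

theorem mpMap_sigma {n K : ℕ} (Q σ : Fin K → MatC n) (p : Equiv.Perm (Fin K))
    (c : Finset (Fin K)) (hp : ∀ j, p j ∈ c ↔ j ∈ c)
    (hd : ∀ i ∈ c, ∀ j ∈ c, (Q i * σ j).trace = if i = j then 1 else 0)
    (j : Fin K) (hj : j ∈ c) :
    mpMap Q σ p c (σ (p j)) = σ j := by
  rw [mpMap_apply, Finset.sum_eq_single j]
  · simp [hd (p j) ((hp j).2 hj) (p j) ((hp j).2 hj)]
  · intro b hb hne
    rw [hd (p b) ((hp b).2 hb) (p j) ((hp j).2 hj), if_neg (fun h => hne (p.injective h)), zero_smul]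
  · intro h; exact absurd hj h

theorem mpMap_coord_pow {n K : ℕ} (Q σ : Fin K → MatC n) (p : Equiv.Perm (Fin K))
    (c : Finset (Fin K)) (hp : ∀ j, p j ∈ c ↔ j ∈ c)
    (hd : ∀ i ∈ c, ∀ j ∈ c, (Q i * σ j).trace = if i = j then 1 else 0)
    (A : MatC n) (k : Fin K) (hk : k ∈ c) (m : ℕ) :
    (p ^ m) k ∈ c ∧ (Q k * ((mpMap Q σ p c) ^ m) A).trace = (Q ((p ^ m) k) * A).trace := by
  induction m generalizing A with
  | zero => simp [hk]
  | succ m ih =>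
    have h1 := (ih A).1
    refine ⟨by rw [pow_succ', Equiv.Perm.mul_apply]; exact (hp _).2 h1, ?_⟩
    rw [pow_succ, Module.End.mul_apply, (ih _).2, mpMap_coord Q σ p c hd _ _ h1, pow_succ',
      Equiv.Perm.mul_apply]

/-- an element fixed up to a nonzero factor is determined by its coordinates -/
theorem mpMap_eig_zero {n K : ℕ} (Q σ : Fin K → MatC n) (p : Equiv.Perm (Fin K))
    (c : Finset (Fin K)) (hp : ∀ j, p j ∈ c ↔ j ∈ c)
    (hd : ∀ i ∈ c, ∀ j ∈ c, (Q i * σ j).trace = if i = j then 1 else 0)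
    (k : Fin K) (hk : k ∈ c) (htr : ∀ j ∈ c, ∃ m : ℕ, (p ^ m) k = j)
    (A : MatC n) (μ : ℂ) (hμ : μ ≠ 0) (hA : mpMap Q σ p c A = μ • A)
    (h0 : (Q k * A).trace = 0) : A = 0 := by
  have hpow : ∀ m : ℕ, ((mpMap Q σ p c) ^ m) A = μ ^ m • A := by
    intro m
    induction m with
    | zero => simp
    | succ m ih => rw [pow_succ, Module.End.mul_apply, hA, map_smul, ih, smul_smul, pow_succ']
  have hz : ∀ j ∈ c, (Q j * A).trace = 0 := by
    intro j hj
    obtain ⟨m, rfl⟩ := htr j hj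
    rw [← (mpMap_coord_pow Q σ p c hp hd A k hk m).2, hpow]
    simp [h0]
  have : mpMap Q σ p c A = 0 := by
    rw [mpMap_apply]
    exact Finset.sum_eq_zero fun j hj => by rw [hz _ ((hp j).2 hj), zero_smul]
  rw [this] at hA
  exact (smul_eq_zero.1 hA.symm).resolve_left hμ

theorem mpMap_root {n K : ℕ} (Q σ : Fin K → MatC n) (p : Equiv.Perm (Fin K))
    (c : Finset (Fin K)) (hp : ∀ j, p j ∈ c ↔ j ∈ c)
    (hd : ∀ i ∈ c, ∀ j ∈ c, (Q i * σ j).trace = if i = j then 1 else 0)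
    (k : Fin K) (hk : k ∈ c) (htr : ∀ j ∈ c, ∃ m : ℕ, (p ^ m) k = j)
    (N : ℕ) (hN : (p ^ N) k = k)
    (μ : ℂ) (hμ : μ ≠ 0) (he : Module.End.HasEigenvalue (mpMap Q σ p c) μ) : μ ^ N = 1 := by
  obtain ⟨A, hA⟩ := he.exists_hasEigenvector
  have h1 := hA.apply_eq_smul
  have h2 := hA.pow_apply N
  have h3 := (mpMap_coord_pow Q σ p c hp hd A k hk N).2
  rw [h2, hN] at h3
  simp only [Matrix.mul_smul, Matrix.trace_smul, smul_eq_mul] at h3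
  have h4 : (Q k * A).trace ≠ 0 := fun h =>
    hA.2 (mpMap_eig_zero Q σ p c hp hd k hk htr A μ hμ h1 h)
  exact mul_right_cancel₀ h4 (by rw [h3, one_mul])

theorem mpMap_finrank {n K : ℕ} (Q σ : Fin K → MatC n) (p : Equiv.Perm (Fin K))
    (c : Finset (Fin K)) (hp : ∀ j, p j ∈ c ↔ j ∈ c)
    (hd : ∀ i ∈ c, ∀ j ∈ c, (Q i * σ j).trace = if i = j then 1 else 0)
    (k : Fin K) (hk : k ∈ c) (htr : ∀ j ∈ c, ∃ m : ℕ, (p ^ m) k = j)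
    (N : ℕ) (hN0 : 0 < N) (hN : (p ^ N) k = k) (hNm : ∀ m, m < N → (p ^ m) k = k → m = 0)
    (μ : ℂ) (hμ : μ ^ N = 1) :
    Module.finrank ℂ (Module.End.eigenspace (mpMap Q σ p c) μ) = 1 := by
  have hμ0 : μ ≠ 0 := by
    rintro rfl
    rw [zero_pow hN0.ne'] at hμ
    exact zero_ne_one hμ
  have hmem : ∀ m : ℕ, (p ^ m) k ∈ c := fun m =>
    (mpMap_coord_pow Q σ p c hp hd 0 k hk m).1
  set f : ℕ → MatC n := fun m => μ ^ m • σ ((p ^ m) k) with hf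
  set A : MatC n := ∑ m ∈ Finset.range N, f m with hAdef
  have hshift : A = ∑ m ∈ Finset.range N, f (m + 1) := by
    have h1 := Finset.sum_range_succ f N
    have h2 := Finset.sum_range_succ' f N
    have h3 : f N = f 0 := by simp [hf, hμ, hN]
    rw [h1, h3] at h2
    exact add_right_cancel h2
  have hA : mpMap Q σ p c A = μ • A := by
    conv_lhs => rw [hshift]
    rw [map_sum, hAdef, Finset.smul_sum]
    refine Finset.sum_congr rfl fun m _ => ?_
    simp only [hf]
    rw [map_smul, pow_succ' p, Equiv.Perm.mul_apply, mpMap_sigma Q σ p c hp hd _ (hmem m),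
      smul_smul, pow_succ']
  have hcoord : (Q k * A).trace = 1 := by
    rw [hAdef, Finset.mul_sum, Matrix.trace_sum, Finset.sum_eq_single 0]
    · simp [hf, hd k hk k hk]
    · intro m hm hne
      have : k ≠ (p ^ m) k := fun h => hne (hNm m (Finset.mem_range.1 hm) h.symm)
      simp [hf, hd k hk _ (hmem m), this]
    · intro h; exact absurd (Finset.mem_range.2 hN0) h
  rw [finrank_eq_one_iff']
  refine ⟨⟨A, Module.End.mem_eigenspace_iff.2 hA⟩, ?_, ?_⟩
  · intro h
    have : A = 0 := congrArg Subtype.val h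
    rw [this] at hcoord
    simp at hcoord
  · rintro ⟨B, hB⟩
    rw [Module.End.mem_eigenspace_iff] at hB
    refine ⟨(Q k * B).trace, Subtype.ext ?_⟩
    have := mpMap_eig_zero Q σ p c hp hd k hk htr (B - (Q k * B).trace • A) μ hμ0
      (by rw [map_sub, map_smul, hA, hB, smul_sub, smul_comm])
      (by rw [mul_sub, Matrix.trace_sub, Matrix.mul_smul, Matrix.trace_smul, hcoord]; simp)
    exact (sub_eq_zero.1 this).symm

theorem mpMap_semisimple {n K : ℕ} (Q σ : Fin K → MatC n) (p : Equiv.Perm (Fin K))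
    (c : Finset (Fin K)) (hp : ∀ j, p j ∈ c ↔ j ∈ c)
    (hd : ∀ i ∈ c, ∀ j ∈ c, (Q i * σ j).trace = if i = j then 1 else 0)
    (N : ℕ) (hN0 : 0 < N) (hN : ∀ j ∈ c, (p ^ N) j = j) (μ : ℂ) :
    Module.End.maxGenEigenspace (mpMap Q σ p c) μ = Module.End.eigenspace (mpMap Q σ p c) μ := by
  set F := mpMap Q σ p c with hF
  have hsig : ∀ m : ℕ, ∀ j ∈ c, (F ^ m) (σ ((p ^ m) j)) = σ j := by
    intro m
    induction m with
    | zero => simp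
    | succ m ih =>
      intro j hj
      rw [pow_succ, Module.End.mul_apply, pow_succ' p, Equiv.Perm.mul_apply, hF,
        mpMap_sigma Q σ p c hp hd _ (mpMap_coord_pow Q σ p c hp hd 0 j hj m).1]
      exact ih j hj
  have hfix : F ^ N * F = F := by
    ext1 A
    rw [Module.End.mul_apply]
    conv_lhs => rw [hF, mpMap_apply, ← hF]
    conv_rhs => rw [hF, mpMap_apply]
    rw [map_sum]
    refine Finset.sum_congr rfl fun j hj => ?_
    have := hsig N j hj
    rw [hN j hj] at this
    rw [map_smul, this]
  have hpoly : Polynomial.aeval F (Polynomial.X * (Polynomial.X ^ N - 1) : Polynomial ℂ) = 0 := by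
    simp only [map_mul, map_sub, map_pow, Polynomial.aeval_X, map_one]
    rw [mul_sub, mul_one, ← pow_succ', pow_succ, hfix, sub_self]
  have hsep : (Polynomial.X * (Polynomial.X ^ N - 1) : Polynomial ℂ).Separable := by
    refine Polynomial.Separable.mul Polynomial.separable_X ?_ ?_
    · exact Polynomial.X_pow_sub_one_separable_iff.2 (by exact_mod_cast hN0.ne')
    · refine ⟨Polynomial.X ^ (N - 1), -1, ?_⟩
      obtain ⟨M, rfl⟩ : ∃ M, N = M + 1 := ⟨N - 1, by omega⟩
      simp only [Nat.add_sub_cancel]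
      ring
  have hss := Module.End.isSemisimple_of_squarefree_aeval_eq_zero hsep.squarefree hpoly
  exact hss.isFinitelySemisimple.maxGenEigenspace_eq_eigenspace μ

theorem cycle_period {K : ℕ} (p : Equiv.Perm (Fin K)) (k : Fin K) :
    Function.minimalPeriod p k = Nat.card {j // p.SameCycle k j} := by
  classical
  have h := MulAction.minimalPeriod_eq_card (α := Equiv.Perm (Fin K)) (a := p) (b := k)
  have h2 : Nat.card {j // p.SameCycle k j} =
      Nat.card (MulAction.orbit (Subgroup.zpowers p) k) := by
    refine Nat.card_congr (Equiv.subtypeEquivRight fun j => ?_)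
    constructor
    · rintro ⟨i, hi⟩
      exact ⟨⟨p ^ i, i, rfl⟩, hi⟩
    · rintro ⟨⟨_, i, rfl⟩, hi⟩
      exact ⟨i, hi⟩
  rw [h2, Nat.card_eq_fintype_card, ← h]
  rfl

theorem isom_trace {n : ℕ} {a b : Type*} [Fintype a] [Fintype b] [DecidableEq a] [DecidableEq b]
    (V : Matrix (Fin n) a ℂ) (W : Matrix (Fin n) b ℂ) (M : Matrix b b ℂ) :
    (V * Vᴴ * (W * M * Wᴴ)).trace = (V * ((Vᴴ * W) * M * Wᴴ)).trace := by
  simp only [Matrix.mul_assoc]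

/-- the block states -/
def blockState {n : ℕ} {E : MatC n →ₗ[ℂ] MatC n} (D : PeripheralDecomposition E)
    (k : Fin D.K) : MatC n :=
  D.V k * ((1 : Matrix (Fin (D.d k)) (Fin (D.d k)) ℂ) ⊗ₖ D.ρ k) * (D.V k)ᴴ

/-- the block projections -/
def blockProj {n : ℕ} {E : MatC n →ₗ[ℂ] MatC n} (D : PeripheralDecomposition E)
    (k : Fin D.K) : MatC n := D.V k * (D.V k)ᴴ

section
variable {n : ℕ} {E : MatC n →ₗ[ℂ] MatC n} (D : PeripheralDecomposition E)

theorem blockState_pos (k : Fin D.K) : (blockState D k).PosSemidef :=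
  (Matrix.PosSemidef.one.kronecker (D.hρpos k).posSemidef).mul_mul_conjTranspose_same _

theorem block_smul (hd : ∀ k, D.d k = 1) (k : Fin D.K)
    (x : Matrix (Fin (D.d k)) (Fin (D.d k)) ℂ) :
    ∃ y : ℂ, x = y • 1 := by
  have h := hd k
  generalize D.d k = e at *
  subst h
  refine ⟨x 0 0, ?_⟩
  ext i j
  fin_cases i; fin_cases j
  simp

theorem block_embed (k : Fin D.K) (y : ℂ) :
    D.V k * ((y • (1 : Matrix (Fin (D.d k)) (Fin (D.d k)) ℂ)) ⊗ₖ D.ρ k) * (D.V k)ᴴ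
      = y • blockState D k := by
  rw [Matrix.smul_kronecker, Matrix.mul_smul, Matrix.smul_mul, blockState]

theorem blockProj_state (hd : ∀ k, D.d k = 1) (i j : Fin D.K) :
    (blockProj D i * blockState D j).trace = if i = j then 1 else 0 := by
  rw [blockProj, blockState, isom_trace]
  split_ifs with h
  · subst h
    rw [D.hViso, Matrix.one_mul, ← Matrix.mul_assoc, Matrix.trace_mul_comm, ← Matrix.mul_assoc,
      D.hViso, Matrix.one_mul, Matrix.trace_kronecker, D.hρtr]
    simp [hd]
  · simp [D.hVorth i j h]

theorem blockState_trace (hd : ∀ k, D.d k = 1) (j : Fin D.K) :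
    (blockState D j).trace = 1 := by
  rw [blockState, Matrix.trace_mul_comm, ← Matrix.mul_assoc,
      D.hViso, Matrix.one_mul, Matrix.trace_kronecker, D.hρtr]
  simp [hd]

theorem blockProj_mul (i j : Fin D.K) :
    blockProj D i * blockProj D j = if i = j then blockProj D i else 0 := by
  have : blockProj D i * blockProj D j = D.V i * ((D.V i)ᴴ * D.V j) * (D.V j)ᴴ := by
    simp only [blockProj, Matrix.mul_assoc]
  rw [this]
  split_ifs with h
  · subst h
    rw [D.hViso, Matrix.mul_one, blockProj]
  · simp [D.hVorth i j h]

theorem blockProj_pos (i : Fin D.K) : (blockProj D i).PosSemidef :=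
  Matrix.posSemidef_self_mul_conjTranspose _

theorem blockRest_pos (c : Finset (Fin D.K)) :
    (1 - ∑ i ∈ c, blockProj D i).PosSemidef := by
  set S := ∑ i ∈ c, blockProj D i with hS
  have hH : Sᴴ = S := by
    rw [hS, Matrix.conjTranspose_sum]
    exact Finset.sum_congr rfl fun i _ => (blockProj_pos D i).isHermitian
  have hI : S * S = S := by
    rw [hS, Finset.sum_mul]
    refine Finset.sum_congr rfl fun i hi => ?_
    rw [Finset.mul_sum]
    simp [blockProj_mul, hi]
  have : (1 - S) = (1 - S)ᴴ * (1 - S) := by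
    rw [Matrix.conjTranspose_sub, hH, Matrix.conjTranspose_one, sub_mul, mul_sub, mul_sub, hI]
    simp
  rw [this]
  exact Matrix.posSemidef_conjTranspose_mul_self _

/-- the measurement operators -/
def blockQ (c : Finset (Fin D.K)) (j : Fin D.K) : MatC n :=
  blockProj D j + ((c.card : ℂ)⁻¹) • (1 - ∑ i ∈ c, blockProj D i)

theorem blockQ_pos (c : Finset (Fin D.K)) (j : Fin D.K) : (blockQ D c j).PosSemidef := by
  refine (blockProj_pos D j).add ((blockRest_pos D c).smul ?_)
  have : (0 : ℂ) ≤ (((c.card : ℝ)⁻¹ : ℝ) : ℂ) := Complex.zero_le_real.2 (by positivity)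
  simpa using this

theorem blockQ_sum (c : Finset (Fin D.K)) (hc : c.Nonempty) : ∑ j ∈ c, blockQ D c j = 1 := by
  simp only [blockQ]
  rw [Finset.sum_add_distrib, Finset.sum_const, ← Nat.cast_smul_eq_nsmul ℂ, smul_smul,
    mul_inv_cancel₀ (by exact_mod_cast hc.card_ne_zero), one_smul]
  abel

theorem blockQ_dual (hd : ∀ k, D.d k = 1) (c : Finset (Fin D.K)) :
    ∀ i ∈ c, ∀ j ∈ c, (blockQ D c i * blockState D j).trace = if i = j then 1 else 0 := by
  intro i _ j hj
  rw [blockQ, add_mul, Matrix.trace_add, blockProj_state D hd, Matrix.smul_mul, Matrix.trace_smul,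
    sub_mul, Matrix.trace_sub, one_mul, blockState_trace D hd, Finset.sum_mul, Matrix.trace_sum]
  simp [blockProj_state D hd, hj]

theorem block_act (y : Fin D.K → ℂ) :
    E (∑ k, y k • blockState D k) = ∑ k, y (D.perm k) • blockState D k := by
  have h := D.hact (fun k => y k • 1)
  simp only [block_embed] at h
  rw [h]
  refine Finset.sum_congr rfl fun k _ => ?_
  have h1 : Matrix.reindex (finCongr (D.hperm k)) (finCongr (D.hperm k))
      (y (D.perm k) • (1 : Matrix (Fin (D.d (D.perm k))) (Fin (D.d (D.perm k))) ℂ))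
      = y (D.perm k) • 1 := by
    ext a b
    simp [Matrix.one_apply]
  have h2 : D.U k * (D.U k)ᴴ = 1 := Matrix.mem_unitaryGroup_iff.1 (D.hU k)
  rw [h1, Matrix.mul_smul, Matrix.mul_one, Matrix.smul_mul, h2, block_embed]

theorem block_act_single (j : Fin D.K) :
    E (blockState D (D.perm j)) = blockState D j := by
  have h := block_act D (fun i => if i = D.perm j then 1 else 0)
  simpa using h

theorem cycleBlock_eq (hd : ∀ k, D.d k = 1) (k : Fin D.K) :
    cycleBlock D k = Submodule.span ℂ {A | ∃ j, D.perm.SameCycle k j ∧ A = blockState D j} := by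
  apply le_antisymm
  · refine Submodule.span_le.2 ?_
    rintro A ⟨j, hj, x, rfl⟩
    obtain ⟨y, rfl⟩ := block_smul D hd j x
    rw [block_embed]
    exact Submodule.smul_mem _ _ (Submodule.subset_span ⟨j, hj, rfl⟩)
  · refine Submodule.span_mono ?_
    rintro A ⟨j, hj, rfl⟩
    exact ⟨j, hj, 1, rfl⟩

theorem cycleBlock_proj (hd : ∀ k, D.d k = 1) (k : Fin D.K) (A : MatC n)
    (hA : A ∈ cycleBlock D k) : A = ∑ j, (blockProj D j * A).trace • blockState D j := by
  rw [cycleBlock_eq D hd] at hA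
  induction hA using Submodule.span_induction with
  | mem A h =>
    obtain ⟨j, _, rfl⟩ := h
    simp [blockProj_state D hd]
  | zero => simp
  | add A B _ _ hA hB =>
    simp only [mul_add, Matrix.trace_add, add_smul, Finset.sum_add_distrib]
    rw [← hA, ← hB]
  | smul a A _ hA =>
    simp only [Matrix.mul_smul, Matrix.trace_smul, smul_assoc]
    rw [← Finset.smul_sum, ← hA]

theorem cycleBlock_coord_zero (hd : ∀ k, D.d k = 1) (k i : Fin D.K) (hi : ¬ D.perm.SameCycle k i)
    (A : MatC n) (hA : A ∈ cycleBlock D k) : (blockProj D i * A).trace = 0 := by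
  rw [cycleBlock_eq D hd] at hA
  induction hA using Submodule.span_induction with
  | mem A h =>
    obtain ⟨j, hj, rfl⟩ := h
    rw [blockProj_state D hd, if_neg]
    rintro rfl
    exact hi hj
  | zero => simp
  | add A B _ _ hA hB => simp [mul_add, Matrix.trace_add, hA, hB]
  | smul a A _ hA => simp [hA]

theorem cycleBlock_disj (hd : ∀ k, D.d k = 1) (k : Fin D.K) : Disjoint (cycleBlock D k)
    (⨆ j ∈ {j : Fin D.K | ¬ D.perm.SameCycle k j}, cycleBlock D j) := by
  rw [Submodule.disjoint_def]
  intro A hA hA'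
  rw [cycleBlock_proj D hd k A hA]
  refine Finset.sum_eq_zero fun i _ => ?_
  by_cases hi : D.perm.SameCycle k i
  · have hle : (⨆ j ∈ {j : Fin D.K | ¬ D.perm.SameCycle k j}, cycleBlock D j) ≤
        LinearMap.ker ((Matrix.traceLinearMap (Fin n) ℂ ℂ).comp
          (LinearMap.mulLeft ℂ (blockProj D i))) := by
      refine iSup₂_le fun j hj B hB => ?_
      rw [LinearMap.mem_ker]
      exact cycleBlock_coord_zero D hd j i (fun h => hj (hi.trans h.symm)) B hB
    have : (blockProj D i * A).trace = 0 := hle hA'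
    rw [this, zero_smul]
  · rw [cycleBlock_coord_zero D hd k i hi A hA, zero_smul]

theorem recSpace_eq (hd : ∀ k, D.d k = 1) : recSpace E = ⨆ k, cycleBlock D k := by
  apply le_antisymm
  · intro A hA
    obtain ⟨x, rfl⟩ := (D.hX A).1 hA
    refine Submodule.sum_mem _ fun k _ => ?_
    exact (le_iSup (cycleBlock D) k) (Submodule.subset_span ⟨k, Equiv.Perm.SameCycle.refl _ _, x k, rfl⟩)
  · refine iSup_le fun k => ?_
    rw [cycleBlock_eq D hd]
    refine Submodule.span_le.2 ?_
    rintro A ⟨j, _, rfl⟩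
    refine (D.hX _).2 ⟨fun i => (if i = j then (1 : ℂ) else 0) • 1, ?_⟩
    simp only [block_embed]
    simp

open Classical in
/-- the index set of the cycle through `k` -/
def cyc (k : Fin D.K) : Finset (Fin D.K) := Finset.univ.filter fun j => D.perm.SameCycle k j

theorem mem_cyc (k j : Fin D.K) : j ∈ cyc D k ↔ D.perm.SameCycle k j := by
  simp [cyc]

theorem cyc_perm (k j : Fin D.K) : D.perm j ∈ cyc D k ↔ j ∈ cyc D k := by
  simp [mem_cyc]

theorem cyc_congr (k j : Fin D.K) (h : D.perm.SameCycle k j) : cyc D k = cyc D j := by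
  ext i
  rw [mem_cyc, mem_cyc]
  exact ⟨fun h' => h.symm.trans h', fun h' => h.trans h'⟩

/-- the ergodic channel attached to the cycle through `k` -/
def cycChan (k : Fin D.K) : MatC n →ₗ[ℂ] MatC n :=
  mpMap (blockQ D (cyc D k)) (blockState D) D.perm (cyc D k)

theorem cycChan_agree (hd : ∀ k, D.d k = 1) (k : Fin D.K) (A : MatC n)
    (hA : A ∈ cycleBlock D k) : E A = cycChan D k A ∧ cycChan D k A ∈ cycleBlock D k := by
  rw [cycleBlock_eq D hd] at hA ⊢
  induction hA using Submodule.span_induction with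
  | mem A h =>
    obtain ⟨j, hj, rfl⟩ := h
    obtain ⟨i, rfl⟩ := D.perm.surjective j
    have hi : i ∈ cyc D k := (cyc_perm D k i).1 ((mem_cyc D k _).2 hj)
    have h1 : cycChan D k (blockState D (D.perm i)) = blockState D i :=
      mpMap_sigma _ _ _ _ (cyc_perm D k) (blockQ_dual D hd _) i hi
    rw [h1, block_act_single]
    exact ⟨rfl, Submodule.subset_span ⟨i, (mem_cyc D k i).1 hi, rfl⟩⟩
  | zero => simp
  | add A B _ _ hA hB =>
    rw [map_add, map_add, hA.1, hB.1]
    exact ⟨rfl, Submodule.add_mem _ hA.2 hB.2⟩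
  | smul a A _ hA =>
    rw [map_smul, map_smul, hA.1]
    exact ⟨rfl, Submodule.smul_mem _ _ hA.2⟩

theorem perm_pow_card (k : Fin D.K) :
    0 < Nat.card {j // D.perm.SameCycle k j} ∧
    (D.perm ^ Nat.card {j // D.perm.SameCycle k j}) k = k ∧
    (∀ m, m < Nat.card {j // D.perm.SameCycle k j} → (D.perm ^ m) k = k → m = 0) := by
  have hcyc := cycle_period D.perm k
  refine ⟨?_, ?_, ?_⟩
  · haveI : Nonempty {j // D.perm.SameCycle k j} := ⟨⟨k, Equiv.Perm.SameCycle.refl _ _⟩⟩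
    exact Nat.card_pos
  · rw [← hcyc, ← Equiv.Perm.iterate_eq_pow]
    exact Function.iterate_minimalPeriod
  · intro m hm h
    by_contra h0
    rw [← hcyc] at hm
    rw [← Equiv.Perm.iterate_eq_pow] at h
    exact Function.not_isPeriodicPt_of_pos_of_lt_minimalPeriod h0 hm h

theorem cyc_trans (k j : Fin D.K) (hj : j ∈ cyc D k) : ∃ m : ℕ, (D.perm ^ m) k = j := by
  obtain ⟨m, _, h⟩ := ((mem_cyc D k j).1 hj).exists_pow_eq'
  exact ⟨m, h⟩

theorem cycChan_eigen (hd : ∀ k, D.d k = 1) (k : Fin D.K) (μ : ℂ)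
    (hμ : μ ^ Nat.card {j // D.perm.SameCycle k j} = 1) :
    Module.finrank ℂ (Module.End.eigenspace (cycChan D k) μ) = 1 :=
  mpMap_finrank _ _ _ _ (cyc_perm D k) (blockQ_dual D hd _) k
    ((mem_cyc D k k).2 (Equiv.Perm.SameCycle.refl _ _)) (cyc_trans D k) _
    (perm_pow_card D k).1 (perm_pow_card D k).2.1 (perm_pow_card D k).2.2 μ hμ

theorem cycChan_root (hd : ∀ k, D.d k = 1) (k : Fin D.K) (μ : ℂ) (h1 : ‖μ‖ = 1)
    (he : Module.End.HasEigenvalue (cycChan D k) μ) :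
    μ ^ Nat.card {j // D.perm.SameCycle k j} = 1 :=
  mpMap_root _ _ _ _ (cyc_perm D k) (blockQ_dual D hd _) k
    ((mem_cyc D k k).2 (Equiv.Perm.SameCycle.refl _ _)) (cyc_trans D k) _
    (perm_pow_card D k).2.1 μ (by rintro rfl; simp at h1) he

theorem cycChan_gen (hd : ∀ k, D.d k = 1) (k : Fin D.K) (μ : ℂ) :
    Module.End.maxGenEigenspace (cycChan D k) μ = Module.End.eigenspace (cycChan D k) μ := by
  refine mpMap_semisimple _ _ _ _ (cyc_perm D k) (blockQ_dual D hd _) _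
    (perm_pow_card D k).1 ?_ μ
  intro j hj
  obtain ⟨m, rfl⟩ := cyc_trans D k j hj
  rw [← Equiv.Perm.mul_apply, ← pow_add, add_comm, pow_add, Equiv.Perm.mul_apply,
    (perm_pow_card D k).2.1]

end

theorem root_iff (N : ℕ) (hN : 0 < N) (μ : ℂ) : μ ^ N = 1 ↔
    ∃ m : Fin N, μ = Complex.exp (2 * (Real.pi : ℂ) * Complex.I * ((m : ℕ) : ℂ) / ((N : ℕ) : ℂ)) := by
  have hp := Complex.isPrimitiveRoot_exp N hN.ne'
  have hpow : ∀ i : ℕ, Complex.exp (2 * (Real.pi : ℂ) * Complex.I / (N : ℂ)) ^ i =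
      Complex.exp (2 * (Real.pi : ℂ) * Complex.I * (i : ℂ) / ((N : ℕ) : ℂ)) := by
    intro i
    rw [← Complex.exp_nat_mul]
    congr 1
    ring
  constructor
  · intro h
    haveI : NeZero N := ⟨hN.ne'⟩
    obtain ⟨i, hi, rfl⟩ := hp.eq_pow_of_pow_eq_one h
    exact ⟨⟨i, hi⟩, hpow i⟩
  · rintro ⟨m, rfl⟩
    rw [← hpow, pow_right_comm, hp.pow_eq_one, one_pow]

/-- **Quantum channel without a decoherence-free subsystem.**
Let `𝓔` be a quantum channel without a decoherence-free subsystem (all the blocks of the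
structure decomposition of its space of recurrences have `d_k = 1`), and suppose it has a
degenerate peripheral eigenvalue (so it is not ergodic).  Then the permutation `π` splits
into disjoint cycles, the space of recurrences splits accordingly into `𝓔`-invariant
sub-blocks `X_c` (one for each cycle), and `𝓔` acts on each `X_c` as an ergodic quantum
channel `𝓔_c` whose peripheral spectrum is the set of `K_c`-th roots of unity without
degeneracy, where `K_c` is the length of the cycle `c`; in particular
`𝓔(X) = ⊕_c 𝓔_c(X)` for every `X ∈ X(𝓔)`. -/
theorem no_DFS_direct_sum_of_ergodic {n : ℕ} (E : MatC n →ₗ[ℂ] MatC n)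
    (hE : IsQuantumChannel E)
    (D : PeripheralDecomposition E) (hnoDFS : ∀ k, D.d k = 1)
    (hdeg : ∃ μ : ℂ, ‖μ‖ = 1 ∧ Module.End.HasEigenvalue E μ ∧
      1 < Module.finrank ℂ (Module.End.maxGenEigenspace E μ)) :
    ∃ Ec : Fin D.K → (MatC n →ₗ[ℂ] MatC n),
      (∀ k, IsQuantumChannel (Ec k)) ∧
      (∀ k, IsErgodic (Ec k)) ∧
      -- one channel for each cycle of the permutation
      (∀ k j, D.perm.SameCycle k j → Ec k = Ec j) ∧
      -- each cycle sub-block is invariant and `𝓔` acts on it as `𝓔_c`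
      (∀ k, ∀ A ∈ cycleBlock D k, E A = Ec k A ∧ Ec k A ∈ cycleBlock D k) ∧
      -- the peripheral spectrum of `𝓔_c` consists of the `K_c`-th roots of unity
      (∀ k, {μ : ℂ | Module.End.HasEigenvalue (Ec k) μ ∧ ‖μ‖ = 1}
          = {μ : ℂ | ∃ m : Fin (Nat.card {j // D.perm.SameCycle k j}),
              μ = Complex.exp (2 * (Real.pi : ℂ) * Complex.I * ((m : ℕ) : ℂ)
                / ((Nat.card {j // D.perm.SameCycle k j} : ℕ) : ℂ))}) ∧
      -- without degeneracy
      (∀ k (μ : ℂ), Module.End.HasEigenvalue (Ec k) μ → ‖μ‖ = 1 →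
        Module.finrank ℂ (Module.End.maxGenEigenspace (Ec k) μ) = 1) ∧
      -- the space of recurrences is the direct sum of the cycle sub-blocks
      (recSpace E = ⨆ k, cycleBlock D k) ∧
      (∀ k, Disjoint (cycleBlock D k)
        (⨆ j ∈ {j : Fin D.K | ¬ D.perm.SameCycle k j}, cycleBlock D j)) ∧
      -- `𝓔` is the direct sum of the ergodic channels `𝓔_c` on the space of recurrences
      (∀ T : Finset (Fin D.K), (∀ k ∈ T, ∀ j ∈ T, k ≠ j → ¬ D.perm.SameCycle k j) →
        ∀ Y : Fin D.K → MatC n, (∀ k ∈ T, Y k ∈ cycleBlock D k) →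
          E (∑ k ∈ T, Y k) = ∑ k ∈ T, Ec k (Y k)) := by
  have hcard : ∀ k, 0 < Nat.card {j // D.perm.SameCycle k j} := fun k => (perm_pow_card D k).1
  refine ⟨cycChan D, ?_, ?_, ?_, cycChan_agree D hnoDFS, ?_, ?_, recSpace_eq D hnoDFS,
    cycleBlock_disj D hnoDFS, ?_⟩
  · intro k
    exact mpMap_channel _ _ _ _ (cyc_perm D k) (blockQ_pos D _) (blockState_pos D)
      (blockState_trace D hnoDFS)
      (blockQ_sum D _ ⟨k, (mem_cyc D k k).2 (Equiv.Perm.SameCycle.refl _ _)⟩)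
  · intro k
    exact cycChan_eigen D hnoDFS k 1 (one_pow _)
  · intro k j h
    rw [cycChan, cycChan, cyc_congr D k j h]
  · intro k
    ext μ
    rw [Set.mem_setOf_eq, Set.mem_setOf_eq, ← root_iff _ (hcard k)]
    constructor
    · rintro ⟨he, h1⟩
      exact cycChan_root D hnoDFS k μ h1 he
    · intro h
      refine ⟨?_, Complex.norm_eq_one_of_pow_eq_one h (hcard k).ne'⟩
      intro hbot
      have h1 := cycChan_eigen D hnoDFS k μ h
      rw [Module.End.eigenspace, hbot, finrank_bot] at h1
      exact zero_ne_one h1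
  · intro k μ he h1
    rw [cycChan_gen D hnoDFS]
    exact cycChan_eigen D hnoDFS k μ (cycChan_root D hnoDFS k μ h1 he)
  · intro T _ Y hY
    rw [map_sum]
    exact Finset.sum_congr rfl fun k hk => (cycChan_agree D hnoDFS k (Y k) (hY k hk)).1
end
end

section
/- An ergodic quantum channel 𝓔 : B(ℋ) → B(ℋ) cannot have any decoherence-free subsystem: in the structure decomposition of its space of recurrences X(𝓔), every block satisfies d_k = dim ℋ_{k,1} = 1. -/
open Matrix Kronecker
open scoped ComplexOrder
noncomputable section

/-- The action of the channel on block coordinates. -/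
def blockAct {n : ℕ} {E : MatC n →ₗ[ℂ] MatC n} (D : PeripheralDecomposition E)
    (x : (k : Fin D.K) → Matrix (Fin (D.d k)) (Fin (D.d k)) ℂ) :
    (k : Fin D.K) → Matrix (Fin (D.d k)) (Fin (D.d k)) ℂ :=
  fun k => D.U k * (Matrix.reindex (finCongr (D.hperm k)) (finCongr (D.hperm k)) (x (D.perm k)))
    * (D.U k)ᴴ

/-- The embedding of block coordinates. -/
def blockEmb {n : ℕ} {E : MatC n →ₗ[ℂ] MatC n} (D : PeripheralDecomposition E)
    (x : (k : Fin D.K) → Matrix (Fin (D.d k)) (Fin (D.d k)) ℂ) : MatC n :=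
  ∑ k, D.V k * (x k ⊗ₖ D.ρ k) * (D.V k)ᴴ

theorem reindex_aux {a b c : ℕ} (h : a = b) (h' : c = a) (W : Matrix (Fin a) (Fin a) ℂ)
    (y : Matrix (Fin c) (Fin c) ℂ) :
    Matrix.reindex (finCongr h) (finCongr h)
      (W * Matrix.reindex (finCongr h') (finCongr h') y * Wᴴ) =
    Matrix.reindex (finCongr h) (finCongr h) W *
      Matrix.reindex (finCongr (h'.trans h)) (finCongr (h'.trans h)) y *
      (Matrix.reindex (finCongr h) (finCongr h) W)ᴴ := by
  subst h h'
  simp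

theorem reindex_unitary {a b : ℕ} (h : a = b) (W : Matrix (Fin a) (Fin a) ℂ)
    (hW : W * Wᴴ = 1) :
    Matrix.reindex (finCongr h) (finCongr h) W *
      (Matrix.reindex (finCongr h) (finCongr h) W)ᴴ = 1 := by
  subst h
  simpa using hW

theorem reindex_self {K : ℕ} {d : Fin K → ℕ} (x : (k : Fin K) → Matrix (Fin (d k)) (Fin (d k)) ℂ)
    {j k : Fin K} (hjk : j = k) (h : d j = d k) :
    Matrix.reindex (finCongr h) (finCongr h) (x j) = x k := by
  subst hjk
  simp

theorem blockAct_iterate {n : ℕ} {E : MatC n →ₗ[ℂ] MatC n} (D : PeripheralDecomposition E)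
    (i : ℕ) : ∀ k, ∃ (h : D.d (D.perm^[i] k) = D.d k) (W : Matrix (Fin (D.d k)) (Fin (D.d k)) ℂ),
      W * Wᴴ = 1 ∧ ∀ x, (blockAct D)^[i] x k
        = W * Matrix.reindex (finCongr h) (finCongr h) (x (D.perm^[i] k)) * Wᴴ := by
  induction i with
  | zero => exact fun k => ⟨rfl, 1, by simp, fun x => by
      simp only [Function.iterate_zero, id_eq, Matrix.one_mul, Matrix.conjTranspose_one,
        Matrix.mul_one]
      rfl⟩
  | succ i ih =>
    intro k
    obtain ⟨h, W, hW, hx⟩ := ih (D.perm k)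
    refine ⟨h.trans (D.hperm k),
      D.U k * Matrix.reindex (finCongr (D.hperm k)) (finCongr (D.hperm k)) W, ?_, ?_⟩
    · have hU : D.U k * (D.U k)ᴴ = 1 := (Matrix.mem_unitaryGroup_iff).1 (D.hU k)
      have := reindex_unitary (D.hperm k) W hW
      rw [Matrix.conjTranspose_mul, Matrix.mul_assoc, ← Matrix.mul_assoc _ _ (D.U k)ᴴ, this,
        Matrix.one_mul, hU]
    · intro x
      rw [Function.iterate_succ_apply']
      conv_lhs => rw [blockAct]
      rw [hx, reindex_aux, Matrix.conjTranspose_mul]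
      simp only [Matrix.mul_assoc]
      rfl

theorem blockEmb_compress {n : ℕ} {E : MatC n →ₗ[ℂ] MatC n} (D : PeripheralDecomposition E)
    (x : (k : Fin D.K) → Matrix (Fin (D.d k)) (Fin (D.d k)) ℂ) (k : Fin D.K) :
    (D.V k)ᴴ * blockEmb D x * D.V k = x k ⊗ₖ D.ρ k := by
  rw [blockEmb, Matrix.mul_sum, Matrix.sum_mul, Finset.sum_eq_single k]
  · rw [show (D.V k)ᴴ * (D.V k * (x k ⊗ₖ D.ρ k) * (D.V k)ᴴ) * D.V k
      = ((D.V k)ᴴ * D.V k) * (x k ⊗ₖ D.ρ k) * ((D.V k)ᴴ * D.V k) by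
        simp only [Matrix.mul_assoc], D.hViso]
    simp
  · intro j _ hj
    rw [show (D.V k)ᴴ * (D.V j * (x j ⊗ₖ D.ρ j) * (D.V j)ᴴ) * D.V k
      = ((D.V k)ᴴ * D.V j) * (x j ⊗ₖ D.ρ j) * ((D.V j)ᴴ * D.V k) by
        simp only [Matrix.mul_assoc], D.hVorth k j hj.symm]
    simp
  · simp

theorem kron_rho_inj {n : ℕ} {E : MatC n →ₗ[ℂ] MatC n} (D : PeripheralDecomposition E)
    (k : Fin D.K) {a b : Matrix (Fin (D.d k)) (Fin (D.d k)) ℂ}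
    (h : a ⊗ₖ D.ρ k = b ⊗ₖ D.ρ k) : a = b := by
  have htr := D.hρtr k
  ext i j
  have h2 : ∀ s, a i j * D.ρ k s s = b i j * D.ρ k s s := fun s => by
    have := congrFun (congrFun h (i, s)) (j, s)
    simpa only [Matrix.kroneckerMap_apply] using this
  have h3 : a i j * (D.ρ k).trace = b i j * (D.ρ k).trace := by
    simp only [Matrix.trace, Matrix.diag, Finset.mul_sum]
    exact Finset.sum_congr rfl fun s _ => h2 s
  simpa [htr] using h3

/-- Every element fixed by the block action is scalar in each block. -/
theorem fixed_scalar {n : ℕ} {E : MatC n →ₗ[ℂ] MatC n} (hErg : IsErgodic E)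
    (D : PeripheralDecomposition E)
    (x : (k : Fin D.K) → Matrix (Fin (D.d k)) (Fin (D.d k)) ℂ) (hx : blockAct D x = x)
    (k : Fin D.K) : ∃ c : ℂ, x k = c • 1 := by
  have key : ∀ y, blockAct D y = y → blockEmb D y ∈ Module.End.eigenspace E 1 := by
    intro y hy
    rw [Module.End.mem_eigenspace_iff, one_smul]
    have h1 : E (blockEmb D y) = blockEmb D (blockAct D y) := D.hact y
    rw [h1, hy]
  have h1 : blockAct D 1 = 1 := by
    funext j
    have hU : D.U j * (D.U j)ᴴ = 1 := (Matrix.mem_unitaryGroup_iff).1 (D.hU j)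
    simp [blockAct, hU]
  have hne : (⟨_, key 1 h1⟩ : Module.End.eigenspace E 1) ≠ 0 := by
    intro h0
    have h0' : blockEmb D 1 = 0 := congrArg Subtype.val h0
    have h2 := blockEmb_compress D 1 k
    rw [h0'] at h2
    have h3 : (1 : Matrix (Fin (D.d k)) (Fin (D.d k)) ℂ) = 0 := by
      apply kron_rho_inj D k
      simpa using h2.symm
    have := congrFun (congrFun h3 ⟨0, D.hd k⟩) ⟨0, D.hd k⟩
    simp at this
  obtain ⟨c, hc⟩ := (finrank_eq_one_iff_of_nonzero' _ hne).1 hErg ⟨_, key x hx⟩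
  have hc' : c • blockEmb D 1 = blockEmb D x := congrArg Subtype.val hc
  refine ⟨c, kron_rho_inj D k ?_⟩
  rw [← blockEmb_compress D x k, ← hc', Matrix.smul_kronecker]
  have h2 := blockEmb_compress D 1 k
  simp only [Pi.one_apply] at h2
  rw [← h2]
  simp

theorem exists_commuting_nonscalar {N : ℕ} (hN : 1 < N) (W : Matrix (Fin N) (Fin N) ℂ) :
    ∃ y : Matrix (Fin N) (Fin N) ℂ, W * y = y * W ∧ ¬ ∃ c : ℂ, y = c • 1 := by
  by_cases h : ∃ c : ℂ, W = c • 1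
  · obtain ⟨c, rfl⟩ := h
    refine ⟨Matrix.single ⟨0, by omega⟩ ⟨1, hN⟩ 1, by simp, ?_⟩
    rintro ⟨a, ha⟩
    have := congrFun (congrFun ha ⟨0, by omega⟩) ⟨1, hN⟩
    simp [Matrix.one_apply] at this
  · exact ⟨W, rfl, h⟩

theorem blockAct_sum {n : ℕ} {E : MatC n →ₗ[ℂ] MatC n} (D : PeripheralDecomposition E)
    (s : Finset ℕ) (f : ℕ → (k : Fin D.K) → Matrix (Fin (D.d k)) (Fin (D.d k)) ℂ) :
    blockAct D (∑ i ∈ s, f i) = ∑ i ∈ s, blockAct D (f i) := by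
  have hadd : ∀ x y, blockAct D (x + y) = blockAct D x + blockAct D y := by
    intro x y
    funext k
    simp [blockAct, Matrix.mul_add, Matrix.add_mul, Matrix.submatrix_add]
  have hzero : blockAct D 0 = 0 := by
    funext k
    simp [blockAct]
  exact map_sum ({ toFun := blockAct D, map_zero' := hzero, map_add' := hadd } :
    ((k : Fin D.K) → Matrix (Fin (D.d k)) (Fin (D.d k)) ℂ) →+
      ((k : Fin D.K) → Matrix (Fin (D.d k)) (Fin (D.d k)) ℂ)) f s

/-- **An ergodic quantum channel has no decoherence-free subsystem:**
in the structure decomposition of its space of recurrences, every block satisfies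
`d_k = dim ℋ_{k,1} = 1`. -/
theorem ergodic_no_DFS {n : ℕ} (E : MatC n →ₗ[ℂ] MatC n)
    (hE : IsQuantumChannel E) (hErg : IsErgodic E)
    (D : PeripheralDecomposition E) :
    ∀ k, D.d k = 1 := by
  intro k
  by_contra hk
  have hk1 : 1 < D.d k := by have := D.hd k; omega
  have hper : k ∈ Function.periodicPts D.perm :=
    D.perm.injective.mem_periodicPts k
  set L := Function.minimalPeriod D.perm k with hL
  have hLpos : 0 < L := Function.minimalPeriod_pos_of_mem_periodicPts hper
  have hLk : D.perm^[L] k = k := Function.iterate_minimalPeriod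
  obtain ⟨h, W, hW, hWx⟩ := blockAct_iterate D L k
  obtain ⟨y, hy, hns⟩ := exists_commuting_nonscalar hk1 W
  set x : (k : Fin D.K) → Matrix (Fin (D.d k)) (Fin (D.d k)) ℂ := Pi.single k y with hxdef
  have hxk : x k = y := by simp [hxdef]
  have hx0 : ∀ j, j ≠ k → x j = 0 := fun j hj => by simp [hxdef, hj]
  -- `x` is fixed by the `L`-th iterate
  have hfix : (blockAct D)^[L] x = x := by
    funext j
    by_cases hj : j = k
    · subst hj
      rw [hWx, reindex_self x hLk, hxk, hy, Matrix.mul_assoc, hW, Matrix.mul_one]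
    · obtain ⟨h', W', -, hWx'⟩ := blockAct_iterate D L j
      rw [hWx', hx0 (D.perm^[L] j), hx0 j hj]
      · simp
      · intro hc
        exact hj (D.perm.injective.iterate L (hc.trans hLk.symm))
  have hsum : blockAct D (∑ i ∈ Finset.range L, (blockAct D)^[i] x)
      = ∑ i ∈ Finset.range L, (blockAct D)^[i] x := by
    rw [blockAct_sum]
    simp only [← Function.iterate_succ_apply']
    have h1 := Finset.sum_range_succ (fun i => (blockAct D)^[i] x) L
    have h2 := Finset.sum_range_succ' (fun i => (blockAct D)^[i] x) L
    rw [h1] at h2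
    simp only [hfix, Function.iterate_zero, id_eq] at h2
    exact (add_right_cancel h2).symm
  obtain ⟨c, hc⟩ := fixed_scalar hErg D _ hsum k
  apply hns
  refine ⟨c, ?_⟩
  rw [← hc, Finset.sum_apply, Finset.sum_eq_single 0]
  · simp [hxk]
  · intro i hi hi0
    obtain ⟨h', W', -, hWx'⟩ := blockAct_iterate D i k
    rw [hWx', hx0 (D.perm^[i] k)]
    · simp
    · intro hcc
      exact Function.not_isPeriodicPt_of_pos_of_lt_minimalPeriod hi0 (Finset.mem_range.1 hi) hcc
  · intro h0
    exact absurd (Finset.mem_range.2 hLpos) h0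
end
end
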